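/- arXiv:math/0110292 — 3 statements merged into one kernel-verified Lean document; each statement's English description precedes it below -/
import Mathlib

section
/- Every metric continuum X is the image, under a weakly confluent continuous surjection, of a second-countable (i.e., countable weight) hereditarily indecomposable continuum Y of dimension at most one, where 'dimension at most one' means: for all closed sets A, B, C ⊆ Y with A ∩ B ∩ C = ∅ there exist closed sets Y₀, Y₁, Y₂ ⊆ Y with A ⊆ Y₀, B ⊆ Y₁, C ⊆ Y₂, Y₀ ∩ Y₁ ∩ Y₂ = ∅ and Y₀ ∪ Y₁ ∪ Y₂ = Y. -/
/-- A space is hereditarily indecomposable if whenever two subcontinua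
(nonempty compact connected subsets) intersect, one is contained in the other. -/
def HereditarilyIndecomposable (X : Type*) [TopologicalSpace X] : Prop :=
  ∀ K L : Set X, IsCompact K → IsConnected K → IsCompact L → IsConnected L →
    (K ∩ L).Nonempty → K ⊆ L ∨ L ⊆ K

/-- A continuous surjection is weakly confluent if every subcontinuum of the range
is the image of a subcontinuum of the domain. -/
def WeaklyConfluent {Y X : Type*} [TopologicalSpace Y] [TopologicalSpace X]
    (f : Y → X) : Prop :=
  ∀ K : Set X, IsCompact K → IsConnected K →
    ∃ L : Set Y, IsCompact L ∧ IsConnected L ∧ f '' L = K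

/-- Dimension at most one, phrased via closed covers: for all closed sets `A`, `B`, `C`
with empty intersection there is a closed cover `Y₀, Y₁, Y₂` of the space with
`A ⊆ Y₀`, `B ⊆ Y₁`, `C ⊆ Y₂` and `Y₀ ∩ Y₁ ∩ Y₂ = ∅`. -/
def DimLeOne (Y : Type*) [TopologicalSpace Y] : Prop :=
  ∀ A B C : Set Y, IsClosed A → IsClosed B → IsClosed C → A ∩ B ∩ C = ∅ →
    ∃ Y₀ Y₁ Y₂ : Set Y, IsClosed Y₀ ∧ IsClosed Y₁ ∧ IsClosed Y₂ ∧
      A ⊆ Y₀ ∧ B ⊆ Y₁ ∧ C ⊆ Y₂ ∧ Y₀ ∩ Y₁ ∩ Y₂ = ∅ ∧ Y₀ ∪ Y₁ ∪ Y₂ = Set.univ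

open Set Filter Topology

theorem exists_continuum_of_limit {ι α β : Type*} [TopologicalSpace α] [TopologicalSpace β]
    [T2Space β] [T2Space α] (l : Filter ι) [l.NeBot] {C : Set β} (hC : IsCompact C)
    {L : ι → Set β} (hLC : ∀ i, L i ⊆ C) (hL : ∀ i, IsConnected (L i)) {p : β → α}
    (hp : Continuous p) {K : Set α} (hK : IsClosed K) (hLK : ∀ i, p '' L i = K) :
    ∃ M ⊆ C, IsCompact M ∧ IsConnected M ∧ p '' M = K ∧
      (∀ F : Set β, IsClosed F → (∀ᶠ i in l, L i ⊆ F) → M ⊆ F) ∧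
      ∀ (s : ι → β) (z : β), (∀ i, s i ∈ L i) → Tendsto s l (𝓝 z) → z ∈ M := by
  let U : Ultrafilter ι := Ultrafilter.of l
  have hU : (U : Filter ι) ≤ l := Ultrafilter.of_le l
  let M : Set β := {z | ∀ N ∈ 𝓝 z, ∀ᶠ i in (U : Filter ι), (L i ∩ N).Nonempty}
  have hlim : ∀ s : ι → β, (∀ᶠ i in (U : Filter ι), s i ∈ L i) →
      ∃ z ∈ M, Tendsto s U (𝓝 z) := by
    intro s hs
    obtain ⟨z, -, hz⟩ := hC.ultrafilter_le_nhds (U.map s) (by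
      rw [le_principal_iff]
      exact hs.mono fun i hi => hLC i hi)
    refine ⟨z, fun N hN => ?_, hz⟩
    filter_upwards [hs, hz hN] with i h1 h2 using ⟨s i, h1, h2⟩
  have hMF : ∀ F : Set β, IsClosed F → (∀ᶠ i in (U : Filter ι), L i ⊆ F) → M ⊆ F := by
    intro F hF h z hz
    by_contra hzF
    obtain ⟨i, h1, x, h2, h3⟩ := (h.and (hz _ (hF.isOpen_compl.mem_nhds hzF))).exists
    exact h3 (h1 h2)
  have hMC : M ⊆ C := hMF C hC.isClosed (Eventually.of_forall hLC)
  have hMclosed : IsClosed M := by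
    rw [← isOpen_compl_iff, isOpen_iff_mem_nhds]
    intro z hz
    simp only [M, mem_compl_iff, mem_ofPred_eq, not_forall] at hz
    obtain ⟨N, hN, h⟩ := hz
    filter_upwards [interior_mem_nhds.2 hN] with y hy hyM
    exact h ((hyM _ (isOpen_interior.mem_nhds hy)).mono
      fun i hi => hi.mono (inter_subset_inter_right _ interior_subset))
  have hMcompact : IsCompact M := hC.of_isClosed_subset hMclosed hMC
  refine ⟨M, hMC, hMcompact, ⟨?_, ?_⟩, ?_, fun F hF h => hMF F hF (hU h),
    fun s z hs hz N hN => (hz.mono_left hU).eventually hN |>.mono fun i hi => ⟨s i, hs i, hi⟩⟩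
  · obtain ⟨z, hz, -⟩ := hlim (fun i => (hL i).nonempty.some)
      (Eventually.of_forall fun i => (hL i).nonempty.some_mem)
    exact ⟨z, hz⟩
  · rw [isPreconnected_iff_subset_of_fully_disjoint_closed hMclosed]
    intro u v hu hv huv hd
    by_contra! h
    obtain ⟨⟨y, hyM, hyu⟩, ⟨x, hxM, hxv⟩⟩ := And.imp not_subset.1 not_subset.1 h
    have hxu : y ∈ v := (huv hyM).resolve_left hyu
    have hyv : x ∈ u := (huv hxM).resolve_right hxv
    obtain ⟨O₁, O₂, ho₁, ho₂, h₁, h₂, hO⟩ := SeparatedNhds.of_isCompact_isCompact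
      (hMcompact.inter_right hu) (hMcompact.inter_right hv)
      (hd.mono inter_subset_right inter_subset_right)
    have hsub : ∀ᶠ i in (U : Filter ι), L i ⊆ O₁ ∪ O₂ := by
      by_contra hn
      rw [← Ultrafilter.eventually_not] at hn
      have hn' : ∀ᶠ i in (U : Filter ι), ∃ x ∈ L i, x ∉ O₁ ∪ O₂ :=
        hn.mono fun i hi => not_subset.1 hi
      obtain ⟨i₀, x₀, -⟩ := hn'.exists
      have : Nonempty β := ⟨x₀⟩
      choose! s hs using fun i (hi : ∃ x ∈ L i, x ∉ O₁ ∪ O₂) => hi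
      obtain ⟨z, hzM, hz⟩ := hlim s (hn'.mono fun i hi => (hs i hi).1)
      have hzO : z ∈ (O₁ ∪ O₂)ᶜ := (ho₁.union ho₂).isClosed_compl.mem_of_tendsto hz
        (hn'.mono fun i hi => (hs i hi).2)
      exact hzO ((huv hzM).imp (fun h => h₁ ⟨hzM, h⟩) fun h => h₂ ⟨hzM, h⟩)
    obtain ⟨i, ⟨hi, hi₁⟩, hi₂⟩ := ((hsub.and (hxM _ (ho₁.mem_nhds (h₁ ⟨hxM, hyv⟩)))).and
      (hyM _ (ho₂.mem_nhds (h₂ ⟨hyM, hxu⟩)))).exists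
    obtain ⟨w, -, hw₁, hw₂⟩ := (hL i).isPreconnected O₁ O₂ ho₁ ho₂ hi hi₁ hi₂
    exact disjoint_left.1 hO hw₁ hw₂
  · refine Subset.antisymm ?_ fun y hy => ?_
    · rw [image_subset_iff]
      exact hMF _ (hK.preimage hp)
        (Eventually.of_forall fun i => image_subset_iff.1 (hLK i).subset)
    · have : ∀ i, ∃ z ∈ L i, p z = y := fun i => (hLK i).symm.subset hy
      choose s hs hsy using this
      obtain ⟨z, hzM, hz⟩ := hlim s (Eventually.of_forall hs)
      refine ⟨z, hzM, tendsto_nhds_unique ((hp.tendsto z).comp hz) ?_⟩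
      exact tendsto_const_nhds.congr fun i => (hsy i).symm

/-- `p` maps the continuum `T` into `S` so that each subcontinuum of `S` is the image of
a subcontinuum of `T`. -/
structure LiftsContinua {α β : Type*} [TopologicalSpace α] [TopologicalSpace β] (p : β → α)
    (S : Set α) (T : Set β) : Prop where
  isCompact : IsCompact T
  isConnected : IsConnected T
  mapsTo : MapsTo p T S
  exists_lift : ∀ K ⊆ S, IsCompact K → IsConnected K →
    ∃ L ⊆ T, IsCompact L ∧ IsConnected L ∧ p '' L = K

theorem LiftsContinua.comp {α β γ : Type*} [TopologicalSpace α] [TopologicalSpace β]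
    [TopologicalSpace γ] {p : β → α} {q : γ → β} {S : Set α} {T : Set β} {W : Set γ}
    (hp : LiftsContinua p S T) (hq : LiftsContinua q T W) : LiftsContinua (p ∘ q) S W where
  isCompact := hq.isCompact
  isConnected := hq.isConnected
  mapsTo := hp.mapsTo.comp hq.mapsTo
  exists_lift K hKS hK hK' := by
    obtain ⟨L, hLT, hL, hL', rfl⟩ := hp.exists_lift K hKS hK hK'
    obtain ⟨M, hMW, hM, hM', rfl⟩ := hq.exists_lift L hLT hL hL'
    exact ⟨M, hMW, hM, hM', image_comp p q M⟩

theorem LiftsContinua.image {α β γ : Type*} [TopologicalSpace α] [TopologicalSpace β]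
    [TopologicalSpace γ] {p : β → α} {S : Set α} {T : Set β} (hp : LiftsContinua p S T)
    {g : β → γ} {q : γ → α} (hg : ContinuousOn g T) (hq : EqOn (q ∘ g) p T) :
    LiftsContinua q S (g '' T) where
  isCompact := hp.isCompact.image_of_continuousOn hg
  isConnected := hp.isConnected.image g hg
  mapsTo := by
    rintro _ ⟨x, hx, rfl⟩
    have : q (g x) = p x := hq hx
    exact this ▸ hp.mapsTo hx
  exists_lift K hKS hK hK' := by
    obtain ⟨L, hLT, hL, hL', rfl⟩ := hp.exists_lift K hKS hK hK'
    refine ⟨g '' L, image_mono hLT, hL.image_of_continuousOn (hg.mono hLT),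
      hL'.image g (hg.mono hLT), ?_⟩
    rw [← image_comp]
    exact (hq.mono hLT).image_eq

/-- The inverse of the zigzag `t + 2`, `-t`, `t - 2` with turns at `t = -1` and `t = 1`. -/
def Zigzag (s t : ℝ) : Prop :=
  (t = s - 2 ∧ s ≤ 1) ∨ (t = -s ∧ -1 ≤ s ∧ s ≤ 1) ∨ (t = s + 2 ∧ -1 ≤ s)

section Zigzag

variable {α : Type*} (φ : α → ℝ)

/-- The pullback over `S` of the zigzag along `φ`. -/
def zigzagPullback (S : Set α) : Set (α × ℝ) := {q | q.1 ∈ S ∧ Zigzag (φ q.1) q.2}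

open Classical in
/-- The signed number of points of `D` over `x`, for `D` a set in the zigzag pullback. -/
noncomputable def zigzagCount (D : Set (α × ℝ)) (x : α) : ℤ :=
  D.indicator 1 (x, min (φ x) 1 - 2) - D.indicator 1 (x, -max (-1) (min (φ x) 1)) +
    D.indicator 1 (x, max (φ x) (-1) + 2)

variable {φ}

theorem zigzagCount_union {D E : Set (α × ℝ)} (h : Disjoint D E) (x : α) :
    zigzagCount φ (D ∪ E) x = zigzagCount φ D x + zigzagCount φ E x := by
  simp only [zigzagCount, indicator_union_of_disjoint h]
  ring

theorem zigzagCount_eq_zero {D : Set (α × ℝ)} {x : α} (h : ∀ q ∈ D, q.1 ≠ x) :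
    zigzagCount φ D x = 0 := by
  have (t : ℝ) : (x, t) ∉ D := fun ht => h _ ht rfl
  simp [zigzagCount, this]

theorem zigzagCount_inter {D : Set (α × ℝ)} {K : Set α} {x : α} (hx : x ∈ K) :
    zigzagCount φ (D ∩ Prod.fst ⁻¹' K) x = zigzagCount φ D x := by
  have h (t : ℝ) : (D ∩ Prod.fst ⁻¹' K).indicator (1 : α × ℝ → ℤ) (x, t) =
      D.indicator 1 (x, t) := by
    by_cases h : (x, t) ∈ D <;> simp [h, hx]
  simp only [zigzagCount, h]

theorem zigzagCount_pullback {S : Set α} {x : α} (hx : x ∈ S) :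
    zigzagCount φ (zigzagPullback φ S) x = 1 := by
  rcases lt_or_ge 1 (φ x) with h | h
  · have h' : -1 ≤ φ x := by linarith
    rw [zigzagCount, min_eq_right h.le, max_eq_left h', max_eq_right (by norm_num)]
    norm_num [zigzagPullback, hx, Zigzag, h']
  rcases lt_or_ge (φ x) (-1) with h' | h'
  · rw [zigzagCount, min_eq_left h, max_eq_right h'.le, max_eq_left h'.le]
    norm_num [zigzagPullback, hx, Zigzag, h]
  · rw [zigzagCount, min_eq_left h, max_eq_right h', max_eq_left h']
    norm_num [zigzagPullback, hx, Zigzag, h, h']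

variable [TopologicalSpace α]

theorem isCompact_zigzagPullback (hφ : Continuous φ) {S : Set α} (hS : IsCompact S) :
    IsCompact (zigzagPullback φ S) := by
  have h : zigzagPullback φ S =
      (fun x => (x, φ x - 2)) '' (S ∩ {x | φ x ≤ 1}) ∪
      ((fun x => (x, -φ x)) '' (S ∩ {x | -1 ≤ φ x ∧ φ x ≤ 1}) ∪
      (fun x => (x, φ x + 2)) '' (S ∩ {x | -1 ≤ φ x})) := by
    ext ⟨x, t⟩
    simp only [zigzagPullback, Zigzag, mem_ofPred_eq, mem_union, mem_image, mem_inter_iff,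
      Prod.mk.injEq]
    constructor
    · rintro ⟨hx, ⟨rfl, h⟩ | ⟨rfl, h⟩ | ⟨rfl, h⟩⟩
      · exact Or.inl ⟨x, ⟨hx, h⟩, rfl, rfl⟩
      · exact Or.inr (Or.inl ⟨x, ⟨hx, h⟩, rfl, rfl⟩)
      · exact Or.inr (Or.inr ⟨x, ⟨hx, h⟩, rfl, rfl⟩)
    · rintro (⟨x, ⟨hx, h⟩, rfl, rfl⟩ | ⟨x, ⟨hx, h⟩, rfl, rfl⟩ | ⟨x, ⟨hx, h⟩, rfl, rfl⟩)
      · exact ⟨hx, Or.inl ⟨rfl, h⟩⟩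
      · exact ⟨hx, Or.inr (Or.inl ⟨rfl, h⟩)⟩
      · exact ⟨hx, Or.inr (Or.inr ⟨rfl, h⟩)⟩
  rw [h]
  refine ((hS.inter_right ?_).image (by fun_prop)).union
    (((hS.inter_right ?_).image (by fun_prop)).union
      ((hS.inter_right ?_).image (by fun_prop)))
  · exact isClosed_le hφ continuous_const
  · exact (isClosed_le continuous_const hφ).inter (isClosed_le hφ continuous_const)
  · exact isClosed_le continuous_const hφ

theorem zigzagCount_const [CompactSpace α] [T2Space α] (hφ : Continuous φ) {K : Set α}
    (hK : IsPreconnected K)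
    {D : Set (α × ℝ)} (hD : IsCompact D)
    (hD' : IsCompact (zigzagPullback φ K \ D)) {x y : α} (hx : x ∈ K) (hy : y ∈ K) :
    zigzagCount φ D x = zigzagCount φ D y := by
  obtain ⟨χ, hχ₀, hχ₁, -⟩ := exists_continuous_zero_one_of_isClosed hD'.isClosed hD.isClosed
    disjoint_sdiff_left
  have hχ (x : α) (t : ℝ) (hx : x ∈ K) (ht : Zigzag (φ x) t) :
      ((D.indicator 1 (x, t) : ℤ) : ℝ) = χ (x, t) := by
    by_cases h : (x, t) ∈ D
    · simp [h, hχ₁ h]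
    · have : χ (x, t) = 0 := hχ₀ (show (x, t) ∈ zigzagPullback φ K \ D from ⟨⟨hx, ht⟩, h⟩)
      simp [h, this]
  have hcount : ∀ x ∈ K, ((zigzagCount φ D x : ℤ) : ℝ) =
      χ (x, min (φ x) 1 - 2) - χ (x, -max (-1) (min (φ x) 1)) + χ (x, max (φ x) (-1) + 2) := by
    intro x hx
    rcases lt_or_ge 1 (φ x) with h | h
    · have h' : -1 ≤ φ x := by linarith
      rw [zigzagCount, min_eq_right h.le, max_eq_left h', max_eq_right (by norm_num),
        show (1 : ℝ) - 2 = -1 by norm_num, sub_self, sub_self, zero_add, zero_add]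
      exact hχ _ _ hx (Or.inr (Or.inr ⟨rfl, h'⟩))
    rcases lt_or_ge (φ x) (-1) with h' | h'
    · rw [zigzagCount, min_eq_left h, max_eq_right h'.le, max_eq_left h'.le,
        show (-1 : ℝ) + 2 = - -1 by norm_num, sub_add_cancel, sub_add_cancel]
      exact hχ _ _ hx (Or.inl ⟨rfl, h⟩)
    · rw [zigzagCount, min_eq_left h, max_eq_right h', max_eq_left h', Int.cast_add,
        Int.cast_sub, hχ _ _ hx (Or.inl ⟨rfl, h⟩), hχ _ _ hx (Or.inr (Or.inl ⟨rfl, h', h⟩)),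
        hχ _ _ hx (Or.inr (Or.inr ⟨rfl, h'⟩))]
  have hcont : ContinuousOn (zigzagCount φ D) K := by
    rw [Int.isClosedEmbedding_coe_real.isEmbedding.continuousOn_iff]
    refine ContinuousOn.congr (Continuous.continuousOn ?_) hcount
    fun_prop
  exact hK.constant hcont hx hy

/-- A relatively clopen part of the zigzag pullback with nonzero count has a component all of
whose clopen neighbourhoods contain a clopen set with nonzero count. -/
theorem exists_essential_point {K : Set α} {R : Set (α × ℝ)} (hR : IsCompact R)
    {x : α} (hx : x ∈ K) (hxR : zigzagCount φ R x ≠ 0) :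
    ∃ p : R, ∀ Z : Set R, IsClopen Z → p ∈ Z →
      ∃ Z' ⊆ Z, IsClopen Z' ∧ ∃ x ∈ K, zigzagCount φ (Subtype.val '' Z') x ≠ 0 := by
  by_contra! h
  have := isCompact_iff_compactSpace.1 hR
  obtain ⟨Z, hZ, hnull⟩ : ∃ Z : Set R, univ ⊆ Z ∧ ∀ Z' ⊆ Z, IsClopen Z' →
      ∀ x ∈ K, zigzagCount φ (Subtype.val '' Z') x = 0 := by
    suffices ∃ Z : Set R, univ ⊆ Z ∧ IsClopen Z ∧ ∀ Z' ⊆ Z, IsClopen Z' →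
        ∀ x ∈ K, zigzagCount φ (Subtype.val '' Z') x = 0 by
      obtain ⟨Z, h₁, -, h₂⟩ := this
      exact ⟨Z, h₁, h₂⟩
    refine isCompact_univ.induction_on (p := fun s => ∃ Z : Set R, s ⊆ Z ∧ IsClopen Z ∧
      ∀ Z' ⊆ Z, IsClopen Z' → ∀ x ∈ K, zigzagCount φ (Subtype.val '' Z') x = 0) ?_ ?_ ?_ ?_
    · refine ⟨∅, Subset.rfl, isClopen_empty, fun Z' hZ' _ x _ => ?_⟩
      rw [subset_empty_iff.1 hZ', image_empty]
      exact zigzagCount_eq_zero (by simp)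
    · rintro s t hst ⟨Z, hZ, h⟩
      exact ⟨Z, hst.trans hZ, h⟩
    · rintro s t ⟨Z₁, hs, hZ₁, h₁⟩ ⟨Z₂, ht, hZ₂, h₂⟩
      refine ⟨Z₁ ∪ Z₂, union_subset_union hs ht, hZ₁.union hZ₂, fun Z' hZ' hc x hx => ?_⟩
      rw [← inter_union_sdiff Z' Z₁, image_union, zigzagCount_union
        ((disjoint_image_iff Subtype.val_injective).2 (disjoint_sdiff_right.mono_left
          inter_subset_right)),
        h₁ _ inter_subset_right (hc.inter hZ₁) x hx,
        h₂ _ (sdiff_subset_iff.2 hZ') (hc.diff hZ₁) x hx, add_zero]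
    · intro p _
      obtain ⟨Z, hZ, hp, hn⟩ := h p
      exact ⟨Z, mem_nhdsWithin_of_mem_nhds (hZ.isOpen.mem_nhds hp), Z, Subset.rfl, hZ, hn⟩
  refine hxR ?_
  have := hnull univ hZ isClopen_univ x hx
  rwa [image_univ, Subtype.range_coe] at this

variable [CompactSpace α] [T2Space α]

theorem zigzagCount_const_of_isClopen (hφ : Continuous φ) {K : Set α} (hK : IsPreconnected K)
    {R : Set (α × ℝ)} (hRK : R ⊆ zigzagPullback φ K) (hR : IsCompact R)
    (hR' : IsCompact (zigzagPullback φ K \ R)) {Z : Set R} (hZ : IsClopen Z) {x y : α}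
    (hx : x ∈ K) (hy : y ∈ K) :
    zigzagCount φ (Subtype.val '' Z) x = zigzagCount φ (Subtype.val '' Z) y := by
  have := isCompact_iff_compactSpace.1 hR
  refine zigzagCount_const hφ hK (hZ.isClosed.isCompact.image continuous_subtype_val) ?_
    hx hy
  have : zigzagPullback φ K \ Subtype.val '' Z =
      (zigzagPullback φ K \ R) ∪ Subtype.val '' Zᶜ := by
    ext q
    have := @hRK q
    by_cases hq : q ∈ R <;> simp [hq]
    exact fun _ => this hq
  rw [this]
  exact hR'.union (hZ.compl.isClosed.isCompact.image continuous_subtype_val)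

theorem exists_lift_of_zigzagCount_ne_zero (hφ : Continuous φ) {K : Set α}
    (hK : IsConnected K) {R : Set (α × ℝ)} (hRK : R ⊆ zigzagPullback φ K) (hR : IsCompact R)
    (hR' : IsCompact (zigzagPullback φ K \ R)) {x : α} (hx : x ∈ K)
    (hxR : zigzagCount φ R x ≠ 0) :
    ∃ L ⊆ R, IsCompact L ∧ IsConnected L ∧ Prod.fst '' L = K := by
  have := isCompact_iff_compactSpace.1 hR
  obtain ⟨p, hp⟩ := exists_essential_point (φ := φ) hR hx hxR
  refine ⟨Subtype.val '' connectedComponent p, Subtype.coe_image_subset _ _,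
    isClosed_connectedComponent.isCompact.image continuous_subtype_val,
    isConnected_connectedComponent.image _ continuous_subtype_val.continuousOn, ?_⟩
  refine Subset.antisymm ?_ fun y hy => ?_
  · rintro _ ⟨_, ⟨q, -, rfl⟩, rfl⟩
    exact (hRK q.2).1
  · by_contra hyC
    have hcompact : IsCompact {q : R | q.1.1 = y} :=
      (isClosed_eq (by fun_prop) continuous_const).isCompact
    have hempty : {q : R | q.1.1 = y} ∩ ⋂ s : { s : Set R // IsClopen s ∧ p ∈ s }, s.1 = ∅ := by
      rw [← connectedComponent_eq_iInter_isClopen]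
      refine eq_empty_of_forall_notMem fun q hq => hyC ⟨q, ⟨q, hq.2, rfl⟩, hq.1⟩
    have hne : Nonempty { s : Set R // IsClopen s ∧ p ∈ s } := ⟨⟨univ, isClopen_univ, trivial⟩⟩
    obtain ⟨⟨Z, hZ, hpZ⟩, hZy⟩ := hcompact.elim_directed_family_closed
      (fun s : { s : Set R // IsClopen s ∧ p ∈ s } => s.1) (fun s => s.2.1.isClosed) hempty
      (fun s t => ⟨⟨s.1 ∩ t.1, s.2.1.inter t.2.1, s.2.2, t.2.2⟩, inter_subset_left,
        inter_subset_right⟩)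
    obtain ⟨Z', hZ', hc, z, hz, hne⟩ := hp Z hZ hpZ
    refine hne ?_
    rw [zigzagCount_const_of_isClopen hφ hK.isPreconnected hRK hR hR' hc hz hy]
    refine zigzagCount_eq_zero ?_
    rintro _ ⟨q, hq, rfl⟩ hqy
    exact eq_empty_iff_forall_notMem.1 hZy q ⟨hqy, hZ' hq⟩

theorem exists_liftsContinua_zigzag (hφ : Continuous φ) {S : Set α} (hS : IsCompact S)
    (hS' : IsConnected S) :
    ∃ T ⊆ zigzagPullback φ S, LiftsContinua Prod.fst S T := by
  have hP := isCompact_zigzagPullback hφ hS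
  have := isCompact_iff_compactSpace.1 hP
  obtain ⟨x₀, hx₀⟩ := hS'.nonempty
  obtain ⟨p, hp⟩ := exists_essential_point (φ := φ) hP hx₀
    (by rw [zigzagCount_pullback hx₀]; exact one_ne_zero)
  refine ⟨Subtype.val '' connectedComponent p, Subtype.coe_image_subset _ _,
    isClosed_connectedComponent.isCompact.image continuous_subtype_val,
    isConnected_connectedComponent.image _ continuous_subtype_val.continuousOn, ?_, ?_⟩
  · rintro _ ⟨q, -, rfl⟩
    exact q.2.1
  intro K hKS hK hK'
  have key : ∀ Z : { s : Set (zigzagPullback φ S) // IsClopen s ∧ p ∈ s },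
      ∃ L ⊆ Subtype.val '' Z.1, IsCompact L ∧ IsConnected L ∧ Prod.fst '' L = K := by
    rintro ⟨Z, hZ, hpZ⟩
    obtain ⟨Z', hZ', hc, z, hz, hne⟩ := hp Z hZ hpZ
    obtain ⟨y, hy⟩ := hK'.nonempty
    have hKc : IsClosed (Prod.fst ⁻¹' K : Set (α × ℝ)) := hK.isClosed.preimage continuous_fst
    have hdiff : zigzagPullback φ K \ (Subtype.val '' Z' ∩ Prod.fst ⁻¹' K) =
        Subtype.val '' Z'ᶜ ∩ Prod.fst ⁻¹' K := by
      ext q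
      simp only [Set.mem_sdiff, mem_inter_iff, mem_image, mem_preimage, mem_compl_iff]
      constructor
      · rintro ⟨⟨h₁, h₂⟩, h₃⟩
        exact ⟨⟨⟨q, hKS h₁, h₂⟩, fun h => h₃ ⟨⟨_, h, rfl⟩, h₁⟩, rfl⟩, h₁⟩
      · rintro ⟨⟨q, h₁, rfl⟩, h₂⟩
        refine ⟨⟨h₂, q.2.2⟩, ?_⟩
        rintro ⟨⟨q', h₃, h₄⟩, -⟩
        exact h₁ (Subtype.val_injective h₄ ▸ h₃)
    have hcount : zigzagCount φ (Subtype.val '' Z' ∩ Prod.fst ⁻¹' K) y ≠ 0 := by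
      rwa [zigzagCount_inter hy, zigzagCount_const_of_isClopen hφ hS'.isPreconnected Subset.rfl
        hP (by simp) hc (hKS hy) hz]
    have hsub : Subtype.val '' Z' ∩ Prod.fst ⁻¹' K ⊆ zigzagPullback φ K := by
      rintro _ ⟨⟨q, -, rfl⟩, hq⟩
      exact ⟨hq, q.2.2⟩
    obtain ⟨L, hL, h⟩ := exists_lift_of_zigzagCount_ne_zero hφ hK' hsub
      ((hc.isClosed.isCompact.image continuous_subtype_val).inter_right hKc)
      (hdiff ▸ (hc.compl.isClosed.isCompact.image continuous_subtype_val).inter_right hKc)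
      hy hcount
    exact ⟨L, hL.trans (inter_subset_left.trans (image_mono hZ')), h⟩
  choose L hLsub _ hLconn hLimg using key
  let F : Filter { s : Set (zigzagPullback φ S) // IsClopen s ∧ p ∈ s } :=
    ⨅ s : { s : Set (zigzagPullback φ S) // IsClopen s ∧ p ∈ s }, 𝓟 {t | t.1 ⊆ s.1}
  have hne : Nonempty { s : Set (zigzagPullback φ S) // IsClopen s ∧ p ∈ s } :=
    ⟨⟨univ, isClopen_univ, trivial⟩⟩
  have : F.NeBot := by
    refine iInf_neBot_of_directed' ?_ fun s => principal_neBot_iff.2 ⟨s, Subset.rfl⟩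
    intro s t
    refine ⟨⟨s.1 ∩ t.1, s.2.1.inter t.2.1, s.2.2, t.2.2⟩, ?_, ?_⟩ <;>
      refine principal_mono.2 fun u (hu : u.1 ⊆ s.1 ∩ t.1) => hu.trans ?_
    exacts [inter_subset_left, inter_subset_right]
  obtain ⟨M, hMP, hM, hM', hMK, hMF, -⟩ := exists_continuum_of_limit F hP
    (fun s => (hLsub s).trans (Subtype.coe_image_subset _ _)) hLconn continuous_fst
    hK.isClosed hLimg
  refine ⟨M, ?_, hM, hM', hMK⟩
  intro q hq
  refine ⟨⟨q, hMP hq⟩, ?_, rfl⟩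
  rw [connectedComponent_eq_iInter_isClopen, mem_iInter]
  intro s
  obtain ⟨_, h, h'⟩ := hMF _ (s.2.1.isClosed.isCompact.image continuous_subtype_val).isClosed
    (mem_iInf_of_mem s (mem_principal.2 fun t ht => (hLsub t).trans (image_mono ht))) hq
  subst h'
  exact h

end Zigzag

theorem LiftsContinua.of_isPreconnected_fibers {α β : Type*} [TopologicalSpace α]
    [TopologicalSpace β] [T2Space α] [T2Space β] {p : β → α} (hp : Continuous p) {S : Set α}
    {T : Set β} (hS : IsCompact S) (hS' : IsConnected S) (hT : IsCompact T) (hTS : p '' T = S)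
    (hfib : ∀ x ∈ S, IsPreconnected (T ∩ p ⁻¹' {x})) : LiftsContinua p S T := by
  have key : ∀ K ⊆ S, IsCompact K → IsConnected K → IsCompact (T ∩ p ⁻¹' K) ∧
      IsConnected (T ∩ p ⁻¹' K) ∧ p '' (T ∩ p ⁻¹' K) = K := by
    intro K hKS hK hK'
    have himg : p '' (T ∩ p ⁻¹' K) = K := by
      rw [image_inter_preimage, hTS, inter_eq_right.2 hKS]
    have hTK : IsCompact (T ∩ p ⁻¹' K) := hT.inter_right (hK.isClosed.preimage hp)
    refine ⟨hTK, ⟨?_, ?_⟩, himg⟩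
    · exact image_nonempty.1 (himg.symm ▸ hK'.nonempty)
    · rw [isPreconnected_iff_subset_of_fully_disjoint_closed hTK.isClosed]
      intro u v hu hv huv hd
      by_contra! h
      obtain ⟨⟨y, hyT, hyu⟩, ⟨x, hxT, hxv⟩⟩ := And.imp not_subset.1 not_subset.1 h
      have hyv : y ∈ v := (huv hyT).resolve_left hyu
      have hxu : x ∈ u := (huv hxT).resolve_right hxv
      have hcl {w : Set β} (hw : IsClosed w) : IsClosed (p '' (T ∩ p ⁻¹' K ∩ w)) :=
        ((hTK.inter_right hw).image hp).isClosed
      obtain ⟨z, hzK, ⟨a, ⟨⟨haT, -⟩, hau⟩, ha⟩, ⟨b, ⟨⟨hbT, -⟩, hbv⟩, hb⟩⟩ :=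
        isPreconnected_closed_iff.1 hK'.isPreconnected _ _ (hcl hu) (hcl hv)
          (by rw [← image_union, ← inter_union_distrib_left, inter_eq_left.2 huv, himg])
          ⟨p x, hxT.2, mem_image_of_mem p ⟨hxT, hxu⟩⟩ ⟨p y, hyT.2, mem_image_of_mem p ⟨hyT, hyv⟩⟩
      obtain ⟨w, -, hwu, hwv⟩ := isPreconnected_closed_iff.1 (hfib z (hKS hzK)) u v hu hv
        (fun w hw => huv ⟨hw.1, by rw [mem_preimage, show p w = z from hw.2]; exact hzK⟩)
        ⟨a, ⟨haT, ha⟩, hau⟩ ⟨b, ⟨hbT, hb⟩, hbv⟩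
      exact disjoint_left.1 hd hwu hwv
  have hTS' : MapsTo p T S := hTS ▸ mapsTo_image p T
  have huniv := key S Subset.rfl hS hS'
  rw [inter_eq_left.2 (show T ⊆ p ⁻¹' S from hTS')] at huniv
  exact ⟨hT, huniv.2.1, hTS', fun K hKS hK hK' => ⟨_, inter_subset_left, key K hKS hK hK'⟩⟩

section Blowup

/-- The boundary of the standard triangle. -/
def triangleBoundary : Set (Fin 3 → ℝ) :=
  stdSimplex ℝ (Fin 3) ∩ {w | ∃ i, w i = 0}

theorem isCompact_triangleBoundary : IsCompact triangleBoundary := by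
  refine (isCompact_stdSimplex ℝ (Fin 3)).inter_right ?_
  have : {w : Fin 3 → ℝ | ∃ i, w i = 0} = ⋃ i, {w | w i = 0} := by ext; simp
  rw [this]
  exact isClosed_iUnion_of_finite fun i => isClosed_eq (continuous_apply i) continuous_const

theorem isPreconnected_triangleBoundary : IsPreconnected triangleBoundary := by
  have hF (i : Fin 3) : IsPreconnected (stdSimplex ℝ (Fin 3) ∩ {w | w i = 0}) := by
    refine ((convex_stdSimplex ℝ (Fin 3)).inter ?_).isPreconnected
    intro x hx y hy a b _ _ _
    simp only [mem_ofPred_eq] at hx hy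
    simp [hx, hy]
  have hU : triangleBoundary = stdSimplex ℝ (Fin 3) ∩ {w | w 0 = 0} ∪
      stdSimplex ℝ (Fin 3) ∩ {w | w 1 = 0} ∪ stdSimplex ℝ (Fin 3) ∩ {w | w 2 = 0} := by
    ext w
    simp only [triangleBoundary, mem_ofPred_eq, mem_union, mem_inter_iff, Fin.exists_fin_succ]
    simp
    tauto
  rw [hU]
  refine ((hF 0).union (Pi.single 2 1) ?_ ?_ (hF 1)).union (Pi.single 0 1) (Or.inr ?_) ?_ (hF 2)
  all_goals exact ⟨single_mem_stdSimplex ℝ _, by simp⟩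

/-- `w` lies on the boundary of the triangle, on the ray from the barycentre through the point
with barycentric coordinates proportional to `s`. -/
def RadialProj (s w : Fin 3 → ℝ) : Prop :=
  w ∈ triangleBoundary ∧ ∀ i, s i - ⨅ k, s k = (∑ j, (s j - ⨅ k, s k)) * w i

theorem continuous_iInf_fin {n : ℕ} : Continuous fun s : Fin (n + 1) → ℝ => ⨅ k, s k := by
  simp_rw [← Finset.inf'_univ_eq_ciInf]
  exact Continuous.finset_inf'_apply _ fun i _ => continuous_apply i

theorem exists_eq_iInf_fin (s : Fin 3 → ℝ) : ∃ i, s i = ⨅ k, s k :=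
  exists_eq_ciInf_of_finite

theorem radialProj_of_ne_zero {s : Fin 3 → ℝ} (hs : (∑ j, (s j - ⨅ k, s k)) ≠ 0)
    (w : Fin 3 → ℝ) :
    RadialProj s w ↔ w = fun i => (s i - ⨅ k, s k) / ∑ j, (s j - ⨅ k, s k) := by
  constructor
  · rintro ⟨-, h⟩
    ext i
    rw [h i, mul_div_cancel_left₀ _ hs]
  · rintro rfl
    have hle (i) : 0 ≤ s i - ⨅ k, s k := sub_nonneg.2 (ciInf_le (Finite.bddBelow_range s) i)
    refine ⟨⟨⟨fun i => div_nonneg (hle i) (Finset.sum_nonneg fun j _ => hle j), ?_⟩, ?_⟩, ?_⟩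
    · rw [← Finset.sum_div, div_self hs]
    · obtain ⟨i, hi⟩ := exists_eq_iInf_fin s
      exact ⟨i, by simp [hi]⟩
    · intro i
      rw [mul_div_cancel₀ _ hs]

theorem radialProj_of_eq_zero {s : Fin 3 → ℝ} (hs : (∑ j, (s j - ⨅ k, s k)) = 0)
    (w : Fin 3 → ℝ) : RadialProj s w ↔ w ∈ triangleBoundary := by
  refine ⟨And.left, fun h => ⟨h, fun i => ?_⟩⟩
  have hle (i) : 0 ≤ s i - ⨅ k, s k := sub_nonneg.2 (ciInf_le (Finite.bddBelow_range s) i)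
  rw [hs, zero_mul]
  exact (Finset.sum_eq_zero_iff_of_nonneg fun j _ => hle j).1 hs i (Finset.mem_univ i)

theorem isConnected_setOf_radialProj (s : Fin 3 → ℝ) : IsConnected {w | RadialProj s w} := by
  by_cases hs : (∑ j, (s j - ⨅ k, s k)) = 0
  · simp_rw [radialProj_of_eq_zero hs]
    exact ⟨⟨Pi.single 0 1, single_mem_stdSimplex ℝ _, 1, by simp⟩,
      isPreconnected_triangleBoundary⟩
  · simp_rw [radialProj_of_ne_zero hs]
    exact isConnected_singleton

theorem exists_liftsContinua_radialProj {α : Type*} [TopologicalSpace α] [T2Space α]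
    {s : α → Fin 3 → ℝ} (hs : Continuous s) {S : Set α} (hS : IsCompact S)
    (hS' : IsConnected S) :
    ∃ T ⊆ {q : α × (Fin 3 → ℝ) | RadialProj (s q.1) q.2}, LiftsContinua Prod.fst S T := by
  refine ⟨{q | q.1 ∈ S ∧ RadialProj (s q.1) q.2}, fun q hq => hq.2,
    .of_isPreconnected_fibers continuous_fst hS hS' ?_ ?_ ?_⟩
  · refine (hS.prod isCompact_triangleBoundary).of_isClosed_subset ?_
      fun q hq => ⟨hq.1, hq.2.1⟩
    have hm : Continuous fun q : α × (Fin 3 → ℝ) => ⨅ k, s q.1 k :=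
      continuous_iInf_fin.comp (hs.comp continuous_fst)
    have hsi (i) : Continuous fun q : α × (Fin 3 → ℝ) => s q.1 i := by fun_prop
    have heq : {q : α × (Fin 3 → ℝ) | q.1 ∈ S ∧ RadialProj (s q.1) q.2} =
        Prod.fst ⁻¹' S ∩ (Prod.snd ⁻¹' triangleBoundary ∩
          ⋂ i, {q | s q.1 i - ⨅ k, s q.1 k = (∑ j, (s q.1 j - ⨅ k, s q.1 k)) * q.2 i}) := by
      ext; simp [RadialProj]
    rw [heq]
    exact (hS.isClosed.preimage continuous_fst).inter
      ((isCompact_triangleBoundary.isClosed.preimage continuous_snd).inter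
        (isClosed_iInter fun i => isClosed_eq (by fun_prop) (by fun_prop)))
  · refine Subset.antisymm (by rintro _ ⟨q, hq, rfl⟩; exact hq.1) fun x hx => ?_
    obtain ⟨w, hw⟩ := (isConnected_setOf_radialProj (s x)).nonempty
    exact ⟨(x, w), ⟨hx, hw⟩, rfl⟩
  · intro x hx
    convert (isConnected_setOf_radialProj (s x)).isPreconnected.image (fun w => (x, w))
      (by fun_prop) using 1
    ext ⟨y, w⟩
    simp only [mem_inter_iff, mem_ofPred_eq, mem_preimage, mem_singleton_iff, mem_image,
      Prod.mk.injEq]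
    constructor
    · rintro ⟨⟨-, h⟩, rfl⟩
      exact ⟨w, h, rfl, rfl⟩
    · rintro ⟨w, h, rfl, rfl⟩
      exact ⟨⟨hx, h⟩, rfl⟩

end Blowup

/-- The values of the two coordinates added in one step: a point on a zigzag and a point on
the boundary of the triangle. -/
abbrev TowerCell : Type := Icc (-4 : ℝ) 4 × (Fin 3 → Icc (0 : ℝ) 1)

/-- The base point of `TowerCell`. -/
def TowerCell.base : TowerCell := (⟨0, by norm_num, by norm_num⟩, 0)

/-- The ambient space for the inverse limit over `X`. -/
abbrev Tower (X : Type*) : Type _ := X × (ℕ → TowerCell)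

namespace Tower

variable {X : Type*}

/-- Forget the coordinates from the `n`-th one on. -/
def trunc (n : ℕ) (z : Tower X) : Tower X :=
  (z.1, fun k => if k < n then z.2 k else TowerCell.base)

theorem trunc_trunc {m n : ℕ} (h : m ≤ n) (z : Tower X) : trunc m (trunc n z) = trunc m z := by
  refine Prod.ext rfl (funext fun k => ?_)
  by_cases hk : k < m
  · simp [trunc, hk, hk.trans_le h]
  · simp [trunc, hk]

/-- Replace the `n`-th coordinate by the projection of `(t, w)` to `TowerCell`. -/
noncomputable def insertCell (n : ℕ) (q : (Tower X × ℝ) × (Fin 3 → ℝ)) : Tower X :=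
  (q.1.1.1, Function.update q.1.1.2 n (projIcc (-4) 4 (by norm_num) q.1.2,
    fun i => projIcc 0 1 zero_le_one (q.2 i)))

theorem trunc_insertCell {n : ℕ} {q : (Tower X × ℝ) × (Fin 3 → ℝ)}
    (hq : trunc n q.1.1 = q.1.1) : trunc n (insertCell n q) = q.1.1 := by
  conv_rhs => rw [← hq]
  refine Prod.ext rfl (funext fun k => ?_)
  by_cases hk : k < n
  · simp [trunc, insertCell, hk, hk.ne]
  · simp [trunc, hk]

theorem trunc_succ_insertCell {n : ℕ} {q : (Tower X × ℝ) × (Fin 3 → ℝ)}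
    (hq : trunc n q.1.1 = q.1.1) : trunc (n + 1) (insertCell n q) = insertCell n q := by
  refine Prod.ext rfl (funext fun k => ?_)
  rcases lt_trichotomy k n with hk | rfl | hk
  · simp [trunc, hk.le]
  · simp [trunc]
  · have : q.1.1.2 k = TowerCell.base := by
      rw [← hq]
      simp [trunc, hk.le]
    simp [trunc, insertCell, hk.ne', this]

/-- The clamping of the first coordinate to `[-2, 2]`. -/
noncomputable def clamp (v : ℝ) : ℝ := max (-2) (min v 2)

/-- The condition imposed on the coordinates added in one step, in terms of the values `v` of
the given functions. -/
def Solves (v : ℝ × (Fin 3 → ℝ)) (e : TowerCell) : Prop :=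
  Zigzag (clamp v.1) e.1 ∧ RadialProj (fun i => max (v.2 i) 0) (fun i => (e.2 i : ℝ))

variable [TopologicalSpace X]

@[fun_prop]
theorem continuous_trunc (n : ℕ) : Continuous (trunc n : Tower X → Tower X) := by
  refine continuous_fst.prodMk (continuous_pi fun k => ?_)
  by_cases hk : k < n
  · simp only [hk, if_true]
    fun_prop
  · simp only [hk, if_false]
    fun_prop

@[fun_prop]
theorem continuous_insertCell (n : ℕ) :
    Continuous (insertCell n : (Tower X × ℝ) × (Fin 3 → ℝ) → Tower X) := by
  unfold insertCell
  refine Continuous.prodMk (by fun_prop) (Continuous.update (by fun_prop) n ?_)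
  refine (continuous_projIcc.comp (by fun_prop)).prodMk
    (continuous_pi fun i => continuous_projIcc.comp (by fun_prop))

theorem exists_liftsContinua_trunc [CompactSpace X] [T2Space X] {n : ℕ} {S : Set (Tower X)}
    (hS : IsCompact S) (hS' : IsConnected S) (hSn : ∀ z ∈ S, trunc n z = z)
    (F : C(Tower X, ℝ × (Fin 3 → ℝ))) :
    ∃ T : Set (Tower X), LiftsContinua (trunc n) S T ∧ (∀ z ∈ T, trunc (n + 1) z = z) ∧
      ∀ z ∈ T, Solves (F (trunc n z)) (z.2 n) := by
  obtain ⟨T₁, hT₁, hl₁⟩ := exists_liftsContinua_zigzag (φ := fun z => clamp (F z).1)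
    (by unfold clamp; fun_prop) hS hS'
  obtain ⟨T₂, hT₂, hl₂⟩ := exists_liftsContinua_radialProj
    (s := fun q : Tower X × ℝ => fun i => max ((F q.1).2 i) 0) (by fun_prop)
    hl₁.isCompact hl₁.isConnected
  have htr : ∀ q ∈ T₂, trunc n q.1.1 = q.1.1 :=
    fun q hq => hSn _ (hl₁.mapsTo (hl₂.mapsTo hq))
  refine ⟨insertCell n '' T₂, (hl₁.comp hl₂).image (continuous_insertCell n).continuousOn
    fun q hq => trunc_insertCell (htr q hq), ?_, ?_⟩
  · rintro _ ⟨q, hq, rfl⟩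
    exact trunc_succ_insertCell (htr q hq)
  · rintro _ ⟨q, hq, rfl⟩
    rw [trunc_insertCell (htr q hq)]
    have h₁ : Zigzag (clamp (F q.1.1).1) q.1.2 := (hT₁ (hl₂.mapsTo hq)).2
    have h₂ : RadialProj (fun i => max ((F q.1.1).2 i) 0) q.2 := hT₂ hq
    have hc₁ : -2 ≤ clamp (F q.1.1).1 := le_max_left _ _
    have hc₂ : clamp (F q.1.1).1 ≤ 2 := max_le (by norm_num) (min_le_right _ _)
    have hmem : q.1.2 ∈ Icc (-4 : ℝ) 4 := by
      rcases h₁ with ⟨h, h'⟩ | ⟨h, h', h''⟩ | ⟨h, h'⟩ <;> constructor <;> linarith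
    have hmem' (i) : q.2 i ∈ Icc (0 : ℝ) 1 := mem_Icc_of_mem_stdSimplex h₂.1.1 i
    have hcell : (insertCell n q).2 n = (⟨q.1.2, hmem⟩, fun i => ⟨q.2 i, hmem' i⟩) := by
      simp [insertCell, projIcc_of_mem _ hmem, projIcc_of_mem _ (hmem' _)]
    rw [hcell]
    exact ⟨h₁, h₂⟩

theorem exists_tower [CompactSpace X] [T2Space X] [ConnectedSpace X]
    (D : ℕ → C(Tower X, ℝ × (Fin 3 → ℝ))) :
    ∃ S : ℕ → Set (Tower X), (∀ n, LiftsContinua Prod.fst univ (S n)) ∧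
      (∀ n, ∀ z ∈ S n, trunc n z = z) ∧ (∀ n, MapsTo (trunc n) (S (n + 1)) (S n)) ∧
      ∀ n, ∀ z ∈ S (n + 1), Solves (D n (trunc n z)) (z.2 n) := by
  let P (n : ℕ) (S : Set (Tower X)) : Prop :=
    LiftsContinua Prod.fst univ S ∧ ∀ z ∈ S, trunc n z = z
  have step : ∀ n S, P n S → ∃ T, P (n + 1) T ∧ MapsTo (trunc n) T S ∧
      ∀ z ∈ T, Solves (D n (trunc n z)) (z.2 n) := by
    rintro n S ⟨hS, hSn⟩
    obtain ⟨T, hT, hTn, hTD⟩ := exists_liftsContinua_trunc hS.isCompact hS.isConnected hSn (D n)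
    have hT' : LiftsContinua (Prod.fst ∘ trunc n) univ T := hS.comp hT
    exact ⟨T, ⟨hT', hTn⟩, hT.mapsTo, hTD⟩
  let S₀ : Set (Tower X) := range fun x : X => (x, fun _ => TowerCell.base)
  have base : P 0 S₀ := by
    have hc : Continuous fun x : X => ((x, fun _ => TowerCell.base) : Tower X) := by fun_prop
    refine ⟨⟨isCompact_range hc, isConnected_range hc, fun _ _ => trivial,
      fun K _ hK hK' => ⟨_, image_subset_range _ K, hK.image hc, hK'.image _ hc.continuousOn, ?_⟩⟩,
      ?_⟩
    · rw [← image_comp]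
      exact image_id K
    · rintro _ ⟨x, rfl⟩
      simp [trunc]
  choose! next h₁ h₂ h₃ using step
  let S : ℕ → Set (Tower X) := fun n => Nat.rec S₀ (fun n S => next n S) n
  have hS : ∀ n, P n (S n) := fun n => by
    induction n with
    | zero => exact base
    | succ n ih => exact h₁ n _ ih
  exact ⟨S, fun n => (hS n).1, fun n => (hS n).2, fun n => h₂ n _ (hS n),
    fun n => h₃ n _ (hS n)⟩

end Tower

namespace Tower

theorem tendstoUniformly_trunc {X : Type*} [UniformSpace X] :
    TendstoUniformly (fun n (z : Tower X) => trunc n z) id atTop := by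
  rw [tendstoUniformly_iff_tendsto, uniformity_prod, tendsto_inf, tendsto_comap_iff,
    tendsto_comap_iff, Pi.uniformity, tendsto_iInf]
  refine ⟨tendsto_diag_uniformity (fun q : ℕ × Tower X => q.2.1) _, fun k => ?_⟩
  rw [tendsto_comap_iff]
  refine (tendsto_diag_uniformity (fun q : ℕ × Tower X => q.2.2 k) _).congr' ?_
  have : ∀ᶠ n in (atTop : Filter ℕ), k < n := eventually_gt_atTop k
  filter_upwards [this.prod_inl (⊤ : Filter (Tower X))] with q hq
  simp [trunc, hq]

theorem tendsto_trunc {X : Type*} [UniformSpace X] (z : Tower X) :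
    Tendsto (fun n => trunc n z) atTop (𝓝 z) :=
  tendstoUniformly_trunc.tendsto_at z

theorem exists_dense_seq_trunc (X : Type*) [MetricSpace X] [CompactSpace X] {W : Type*}
    [MetricSpace W] [SecondCountableTopology W] [Nonempty W] :
    ∃ D : ℕ → C(Tower X, W), ∀ (F : C(Tower X, W)) (ε : ℝ), 0 < ε →
      ∃ n, ∀ z, dist (D n (trunc n z)) (F z) < ε := by
  have : Nonempty C(Tower X, W) := ⟨.const _ (Classical.arbitrary W)⟩
  refine ⟨fun n => TopologicalSpace.denseSeq C(Tower X, W) n.unpair.1, fun F ε hε => ?_⟩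
  obtain ⟨k, hk⟩ := (TopologicalSpace.denseRange_denseSeq C(Tower X, W)).exists_dist_lt F
    (half_pos hε)
  set G := TopologicalSpace.denseSeq C(Tower X, W) k
  have hG : UniformContinuous G := CompactSpace.uniformContinuous_of_continuous G.continuous
  have hGt := hG.comp_tendstoUniformly (tendstoUniformly_trunc (X := X))
  obtain ⟨m, hm⟩ := eventually_atTop.1 (Metric.tendstoUniformly_iff.1 hGt _ (half_pos hε))
  refine ⟨Nat.pair k m, fun z => ?_⟩
  have h₁ : dist (G z) (G (trunc (Nat.pair k m) z)) < ε / 2 :=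
    hm _ (Nat.right_le_pair k m) z
  have h₂ : dist (F z) (G z) < ε / 2 := (ContinuousMap.dist_apply_le_dist z).trans_lt hk
  simp only [Nat.unpair_pair]
  calc dist (G (trunc (Nat.pair k m) z)) (F z)
      ≤ dist (F z) (G z) + dist (G z) (G (trunc (Nat.pair k m) z)) := by
        rw [dist_comm]; exact dist_triangle _ _ _
    _ < ε := by linarith

/-- A closed set in the tower over `X` that is a continuum lifting all subcontinua of `X` and on
which approximations of all tasks are solved. -/
theorem exists_continuum (X : Type*) [MetricSpace X] [CompactSpace X] [ConnectedSpace X] :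
    ∃ Y : Set (Tower X), LiftsContinua Prod.fst univ Y ∧
      ∀ (F : C(Tower X, ℝ × (Fin 3 → ℝ))) (ε : ℝ), 0 < ε →
        ∃ (G : Tower X → ℝ × (Fin 3 → ℝ)) (e : Tower X → TowerCell), Continuous G ∧
          Continuous e ∧ (∀ z, dist (G z) (F z) < ε) ∧ ∀ z ∈ Y, Solves (G z) (e z) := by
  obtain ⟨D, hD⟩ := exists_dense_seq_trunc X (W := ℝ × (Fin 3 → ℝ))
  obtain ⟨S, hS, hSn, hSt, hSD⟩ := exists_tower D
  have hSm : ∀ n m, n ≤ m → S m ⊆ trunc n ⁻¹' S n := by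
    intro n m hnm
    induction m, hnm using Nat.le_induction with
    | base => intro z hz; rw [mem_preimage, hSn n z hz]; exact hz
    | succ m hnm ih =>
      intro z hz
      have := ih (hSt m hz)
      rwa [mem_preimage, trunc_trunc hnm] at this
  let Y : Set (Tower X) := ⋂ n, trunc n ⁻¹' S n
  have hY : IsClosed Y :=
    isClosed_iInter fun n => (hS n).isCompact.isClosed.preimage (continuous_trunc n)
  have hlim : ∀ K : Set X, IsCompact K → ∀ L : ℕ → Set (Tower X), (∀ n, L n ⊆ S n) →
      (∀ n, IsConnected (L n)) → (∀ n, Prod.fst '' L n = K) → ∃ M ⊆ Y, IsCompact M ∧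
        IsConnected M ∧ Prod.fst '' M = K ∧ ∀ (s : ℕ → Tower X) (z : Tower X),
          (∀ i, s i ∈ L i) → Tendsto s atTop (𝓝 z) → z ∈ M := by
    intro K hK L hLS hL hLK
    obtain ⟨M, -, h₁, h₂, h₃, h₄, h₅⟩ := exists_continuum_of_limit atTop isCompact_univ
      (fun n => subset_univ (L n)) hL continuous_fst hK.isClosed hLK
    refine ⟨M, subset_iInter fun n => h₄ _ ((hS n).isCompact.isClosed.preimage
      (continuous_trunc n)) ?_, h₁, h₂, h₃, h₅⟩
    filter_upwards [eventually_ge_atTop n] with m hm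
    exact (hLS m).trans (hSm n m hm)
  have hYconn : IsConnected Y := by
    obtain ⟨M, hMY, -, hM, -, h⟩ := hlim univ isCompact_univ S (fun n => Subset.rfl)
      (fun n => (hS n).isConnected) (fun n => by
        obtain ⟨L, hL, -, -, h⟩ := (hS n).exists_lift univ Subset.rfl isCompact_univ
          isConnected_univ
        exact univ_subset_iff.1 (h.symm.subset.trans (image_mono hL)))
    rwa [hMY.antisymm fun z hz => h _ z (fun n => mem_iInter.1 hz n) (tendsto_trunc z)] at hM
  refine ⟨Y, ⟨hY.isCompact, hYconn, fun _ _ => trivial, fun K hKS hK hK' => ?_⟩, fun F ε hε => ?_⟩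
  · choose L hL _ hLconn hLK using fun n => (hS n).exists_lift K hKS hK hK'
    obtain ⟨M, h₁, h₂, h₃, h₄, -⟩ := hlim K hK L hL hLconn hLK
    exact ⟨M, h₁, h₂, h₃, h₄⟩
  · obtain ⟨n, hn⟩ := hD F ε hε
    refine ⟨fun z => D n (trunc n z), fun z => z.2 n, by fun_prop, by fun_prop, hn,
      fun z hz => ?_⟩
    have := hSD n _ (mem_iInter.1 hz (n + 1))
    rw [trunc_trunc (Nat.le_succ n)] at this
    simpa [trunc] using this

end Tower

theorem Zigzag.lt_neg_one_of_isPreconnected {β : Type*} [TopologicalSpace β] {K : Set β}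
    (hK : IsPreconnected K) {s t : β → ℝ} (ht : ContinuousOn t K)
    (h : ∀ x ∈ K, Zigzag (s x) (t x)) (hs : ∀ x ∈ K, s x < 1) {p : β} (hp : p ∈ K)
    (hsp : s p < -1) : ∀ x ∈ K, t x < -1 := by
  intro x hx
  by_contra! hlt
  have hpt : t p ≤ -1 := by
    rcases h p hp with ⟨h, -⟩ | ⟨-, h, -⟩ | ⟨-, h⟩ <;> linarith
  obtain ⟨y, hy, hyt⟩ := hK.intermediate_value hp hx ht ⟨hpt, hlt⟩
  have := hs y hy
  rcases h y hy with ⟨h, -⟩ | ⟨h, -, -⟩ | ⟨h, h'⟩ <;> linarith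

theorem Zigzag.neg {s t : ℝ} (h : Zigzag s t) : Zigzag (-s) (-t) := by
  rcases h with ⟨h, h'⟩ | ⟨h, h', h''⟩ | ⟨h, h'⟩
  · exact Or.inr (Or.inr ⟨by linarith, by linarith⟩)
  · exact Or.inr (Or.inl ⟨by linarith, by linarith, by linarith⟩)
  · exact Or.inl ⟨by linarith, by linarith⟩

theorem Zigzag.one_lt_of_isPreconnected {β : Type*} [TopologicalSpace β] {K : Set β}
    (hK : IsPreconnected K) {s t : β → ℝ} (ht : ContinuousOn t K)
    (h : ∀ x ∈ K, Zigzag (s x) (t x)) (hs : ∀ x ∈ K, -1 < s x) {p : β} (hp : p ∈ K)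
    (hsp : 1 < s p) : ∀ x ∈ K, 1 < t x := by
  intro x hx
  have := Zigzag.lt_neg_one_of_isPreconnected hK ht.neg (fun x hx => (h x hx).neg)
    (fun x hx => by linarith [hs x hx]) hp (by linarith) x hx
  simp only [Pi.neg_apply] at this
  linarith

theorem RadialProj.eq_zero {s w : Fin 3 → ℝ} (h : RadialProj (fun i => max (s i) 0) w)
    {i j : Fin 3} (hi : s i ≤ 0) (hj : 0 < s j) : w i = 0 := by
  have hm : ⨅ k, max (s k) 0 = 0 := by
    refine le_antisymm ((ciInf_le (Finite.bddBelow_range _) i).trans ?_)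
      (le_ciInf fun k => le_max_right _ _)
    rw [max_eq_right hi]
  have hpos : 0 < ∑ k, max (s k) 0 :=
    Finset.sum_pos' (fun k _ => le_max_right _ _) ⟨j, Finset.mem_univ j, lt_max_of_lt_left hj⟩
  have := h.2 i
  simp only [hm, sub_zero, max_eq_right hi] at this
  exact (mul_eq_zero.1 this.symm).resolve_left hpos.ne'

/-- Functions that are negative on three given closed sets with empty intersection, but at no
point all small. -/
theorem exists_functions_of_inter_eq_empty {Z : Type*} [TopologicalSpace Z] [NormalSpace Z]
    {A : Fin 3 → Set Z} (hA : ∀ i, IsClosed (A i)) (h : A 0 ∩ A 1 ∩ A 2 = ∅) :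
    ∃ s : Fin 3 → C(Z, ℝ), (∀ i, ∀ z ∈ A i, s i z = -1) ∧ ∀ z, ∃ i, 1 / 2 ≤ s i z := by
  have urysohn : ∀ {B C : Set Z}, IsClosed B → IsClosed C → B ∩ C = ∅ →
      ∃ f : C(Z, ℝ), (∀ z ∈ B, f z = -1) ∧ ∀ z ∈ C, f z = 1 := by
    intro B C hB hC hBC
    obtain ⟨f, hf₀, hf₁, -⟩ := exists_continuous_zero_one_of_isClosed hB hC
      (disjoint_iff_inter_eq_empty.2 hBC)
    refine ⟨⟨fun z => 2 * f z - 1, by fun_prop⟩, fun z hz => ?_, fun z hz => ?_⟩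
    · have : f z = 0 := hf₀ hz
      simp [this]
    · have : f z = 1 := hf₁ hz
      norm_num [this]
  obtain ⟨a, ha, ha'⟩ := urysohn (hA 0) ((hA 1).inter (hA 2)) (by rwa [← inter_assoc])
  have hacl : IsClosed {z | a z ≤ 1 / 2} := isClosed_le a.continuous continuous_const
  obtain ⟨b, hb, hb'⟩ := urysohn (hA 1) ((hA 2).inter hacl) (by
    refine eq_empty_of_forall_notMem fun z hz => ?_
    have h₁ := ha' z ⟨hz.1, hz.2.1⟩
    have h₂ : a z ≤ 1 / 2 := hz.2.2
    linarith)
  have hbcl : IsClosed {z | b z ≤ 1 / 2} := isClosed_le b.continuous continuous_const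
  obtain ⟨c, hc, hc'⟩ := urysohn (hA 2) (hacl.inter hbcl) (by
    refine eq_empty_of_forall_notMem fun z hz => ?_
    have h₁ := hb' z ⟨hz.1, hz.2.1⟩
    have h₂ : b z ≤ 1 / 2 := hz.2.2
    linarith)
  refine ⟨![a, b, c], ?_, fun z => ?_⟩
  · intro i
    fin_cases i
    exacts [ha, hb, hc]
  · by_contra! hlt
    have h₀ : a z < 1 / 2 := hlt 0
    have h₁ : b z < 1 / 2 := hlt 1
    have h₂ : c z < 1 / 2 := hlt 2
    linarith [hc' z ⟨h₀.le, h₁.le⟩]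

section Properties

variable {X : Type*} [MetricSpace X] {Y : Set (Tower X)}

theorem hereditarilyIndecomposable_of_solves
    (h : ∀ (F : C(Tower X, ℝ × (Fin 3 → ℝ))) (ε : ℝ), 0 < ε →
      ∃ (G : Tower X → ℝ × (Fin 3 → ℝ)) (e : Tower X → TowerCell), Continuous G ∧
        Continuous e ∧ (∀ z, dist (G z) (F z) < ε) ∧ ∀ z ∈ Y, Tower.Solves (G z) (e z)) :
    HereditarilyIndecomposable Y := by
  intro K L hK hK' hL hL' ⟨x, hxK, hxL⟩
  by_contra! hKL
  obtain ⟨⟨p, hpK, hpL⟩, ⟨q, hqL, hqK⟩⟩ := And.imp not_subset.1 not_subset.1 hKL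
  have hKc : IsClosed (Subtype.val '' K : Set (Tower X)) :=
    (hK.image continuous_subtype_val).isClosed
  have hLc : IsClosed (Subtype.val '' L : Set (Tower X)) :=
    (hL.image continuous_subtype_val).isClosed
  obtain ⟨f, hf₀, hf₁, hf⟩ := exists_continuous_zero_one_of_isClosed hLc
    (isClosed_singleton (x := p.1)) (by simpa using hpL)
  obtain ⟨g, hg₀, hg₁, hg⟩ := exists_continuous_zero_one_of_isClosed hKc
    (isClosed_singleton (x := q.1)) (by simpa using hqK)
  have hfp : f p = 1 := hf₁ rfl
  have hgq : g q = 1 := hg₁ rfl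
  have hfL (y) (hy : y ∈ L) : f y = 0 := hf₀ (mem_image_of_mem _ hy)
  have hgK (y) (hy : y ∈ K) : g y = 0 := hg₀ (mem_image_of_mem _ hy)
  obtain ⟨G, e, -, he, hGF, hsol⟩ := h ⟨fun z => (2 * (g z - f z), 0), by fun_prop⟩ 1 one_pos
  have hG (z : Tower X) : |(G z).1 - 2 * (g z - f z)| < 1 := by
    have := (le_max_left _ _).trans_lt (hGF z)
    rwa [Real.dist_eq] at this
  have hzig (y : Y) : Zigzag (Tower.clamp (G y).1) (e y).1 := (hsol y y.2).1
  have ht : Continuous fun y : Y => ((e y).1 : ℝ) := by fun_prop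
  have h₁ := Zigzag.lt_neg_one_of_isPreconnected hK'.isPreconnected ht.continuousOn
    (fun y _ => hzig y) (fun y hy => by
      have := abs_lt.1 (hG y)
      have := hf y
      rw [hgK y hy] at *
      simp only [Tower.clamp, max_lt_iff, min_lt_iff]
      exact ⟨by norm_num, Or.inl (by linarith [this.1])⟩) hpK (by
      have := abs_lt.1 (hG p)
      rw [hgK p hpK, hfp] at this
      simp only [Tower.clamp, max_lt_iff, min_lt_iff]
      exact ⟨by norm_num, Or.inl (by linarith)⟩) x hxK
  have h₂ := Zigzag.one_lt_of_isPreconnected hL'.isPreconnected ht.continuousOn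
    (fun y _ => hzig y) (fun y hy => by
      have := abs_lt.1 (hG y)
      have := hg y
      rw [hfL y hy] at *
      simp only [Tower.clamp, lt_max_iff, lt_min_iff]
      exact Or.inr ⟨by linarith [this.1], by norm_num⟩) hqL (by
      have := abs_lt.1 (hG q)
      rw [hfL q hqL, hgq] at this
      simp only [Tower.clamp, lt_max_iff, lt_min_iff]
      exact Or.inr ⟨by linarith, by norm_num⟩) x hxL
  linarith

theorem dimLeOne_of_solves (hY : IsCompact Y)
    (h : ∀ (F : C(Tower X, ℝ × (Fin 3 → ℝ))) (ε : ℝ), 0 < ε →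
      ∃ (G : Tower X → ℝ × (Fin 3 → ℝ)) (e : Tower X → TowerCell), Continuous G ∧
        Continuous e ∧ (∀ z, dist (G z) (F z) < ε) ∧ ∀ z ∈ Y, Tower.Solves (G z) (e z)) :
    DimLeOne Y := by
  intro A B C hA hB hC hABC
  have := isCompact_iff_compactSpace.1 hY
  have hcl : ∀ i, IsClosed (Subtype.val '' ((![A, B, C] : Fin 3 → Set Y) i) : Set (Tower X)) := by
    intro i
    refine (IsCompact.image ?_ continuous_subtype_val).isClosed
    fin_cases i
    exacts [hA.isCompact, hB.isCompact, hC.isCompact]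
  obtain ⟨s, hs, hs'⟩ := exists_functions_of_inter_eq_empty hcl (by
    simp only [Matrix.cons_val]
    rw [← image_inter Subtype.val_injective, ← image_inter Subtype.val_injective, hABC,
      image_empty])
  obtain ⟨G, e, -, he, hGF, hsol⟩ := h ⟨fun z => (0, fun i => s i z), by fun_prop⟩ (1 / 2)
    one_half_pos
  have hG (z : Tower X) (i : Fin 3) : |(G z).2 i - s i z| < 1 / 2 := by
    have := (dist_le_pi_dist _ _ i).trans_lt ((le_max_right _ _).trans_lt (hGF z))
    rwa [Real.dist_eq] at this
  have hrad (y : Y) := (hsol y y.2).2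
  let Y' (i : Fin 3) : Set Y := {y | ((e y).2 i : ℝ) = 0}
  have hY' (i) : IsClosed (Y' i) := isClosed_eq (by fun_prop) continuous_const
  have hsub (i) : (![A, B, C] : Fin 3 → Set Y) i ⊆ Y' i := by
    intro y hy
    obtain ⟨j, hj⟩ := hs' y
    have h₁ := abs_lt.1 (hG y i)
    have h₂ := abs_lt.1 (hG y j)
    rw [hs i y (mem_image_of_mem _ hy)] at h₁
    exact (hrad y).eq_zero (i := i) (j := j) (by linarith) (by linarith)
  refine ⟨Y' 0, Y' 1, Y' 2, hY' 0, hY' 1, hY' 2, hsub 0, hsub 1, hsub 2, ?_, ?_⟩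
  · refine eq_empty_of_forall_notMem fun y hy => ?_
    have hsum := (hrad y).1.1.2
    obtain ⟨⟨h₀, h₁⟩, h₂⟩ := hy
    simp only [Y', mem_ofPred_eq] at h₀ h₁ h₂
    rw [Fin.sum_univ_three, h₀, h₁, h₂] at hsum
    norm_num at hsum
  · refine eq_univ_of_forall fun y => ?_
    obtain ⟨i, hi⟩ := (hrad y).1.2
    fin_cases i
    exacts [Or.inl (Or.inl hi), Or.inl (Or.inr hi), Or.inr hi]

end Properties

theorem LiftsContinua.weaklyConfluent {X Z : Type*} [TopologicalSpace X] [TopologicalSpace Z]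
    {p : Z → X} {Y : Set Z} (h : LiftsContinua p univ Y) :
    WeaklyConfluent fun y : Y => p y := by
  intro K hK hK'
  obtain ⟨L, hLY, hL, hL', hLK⟩ := h.exists_lift K (subset_univ K) hK hK'
  have himg : Subtype.val '' (Subtype.val ⁻¹' L : Set Y) = L := by
    rw [Subtype.image_preimage_coe, inter_eq_right.2 hLY]
  refine ⟨Subtype.val ⁻¹' L, ?_, ⟨?_, ?_⟩, ?_⟩
  · rwa [Topology.IsEmbedding.subtypeVal.isCompact_iff, himg]
  · exact image_nonempty.1 (himg.symm ▸ hL'.nonempty)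
  · rw [← Topology.IsInducing.subtypeVal.isPreconnected_image, himg]
    exact hL'.isPreconnected
  · rw [← hLK]
    conv_rhs => rw [← himg]
    exact (image_image p Subtype.val _).symm

/-- Every metric continuum is the weakly confluent image of a second-countable
hereditarily indecomposable continuum of dimension at most one. -/
theorem mackowiak_tymchatyn_metric (X : Type*) [MetricSpace X] [CompactSpace X]
    [ConnectedSpace X] :
    ∃ (Y : Type) (_ : TopologicalSpace Y) (f : Y → X),
      CompactSpace Y ∧ ConnectedSpace Y ∧ T2Space Y ∧
      SecondCountableTopology Y ∧
      HereditarilyIndecomposable Y ∧ DimLeOne Y ∧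
      Continuous f ∧ Function.Surjective f ∧ WeaklyConfluent f := by
  obtain ⟨ι, hι⟩ := TopologicalSpace.exists_embedding_l_infty X
  let E := hι.toHomeomorph
  have : CompactSpace (range ι) := E.compactSpace
  have : ConnectedSpace (range ι) := E.surjective.connectedSpace E.continuous
  obtain ⟨Y, hY, hsol⟩ := Tower.exists_continuum (range ι)
  have hwc : WeaklyConfluent fun y : Y => E.symm y.1.1 := by
    intro K hK hK'
    obtain ⟨L, hL, hL', hLK⟩ := hY.weaklyConfluent (E '' K) (hK.image E.continuous)
      (hK'.image E E.continuous.continuousOn)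
    refine ⟨L, hL, hL', ?_⟩
    have hEK : E.symm '' (E '' K) = K := by simp [image_image]
    rw [← hLK, image_image] at hEK
    exact hEK
  refine ⟨Y, inferInstance, fun y => E.symm y.1.1, isCompact_iff_compactSpace.1 hY.isCompact,
    isConnected_iff_connectedSpace.1 hY.isConnected, inferInstance, inferInstance,
    hereditarilyIndecomposable_of_solves hsol, dimLeOne_of_solves hY.isCompact hsol,
    by fun_prop, ?_, hwc⟩
  obtain ⟨L, -, -, hL⟩ := hwc univ isCompact_univ isConnected_univ
  intro x
  obtain ⟨y, -, hy⟩ := hL.symm.subset (mem_univ x)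
  exact ⟨y, hy⟩
end

section
/- Every continuum X (compact connected Hausdorff, not necessarily metrizable) is the image, under a weakly confluent continuous surjection, of a hereditarily indecomposable continuum Y whose weight equals the weight of X and which has dimension at most one, where 'dimension at most one' means: for all closed sets A, B, C ⊆ Y with A ∩ B ∩ C = ∅ there exist closed sets Y₀, Y₁, Y₂ ⊆ Y with A ⊆ Y₀, B ⊆ Y₁, C ⊆ Y₂, Y₀ ∩ Y₁ ∩ Y₂ = ∅ and Y₀ ∪ Y₁ ∪ Y₂ = Y. -/
universe u

/-- The weight of a topological space: the least cardinality of a base for its topology. -/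
noncomputable def weight (X : Type u) [TopologicalSpace X] : Cardinal.{u} :=
  ⨅ B : {B : Set (Set X) // TopologicalSpace.IsTopologicalBasis B}, Cardinal.mk B.1


/-- A continuum lying in an ambient space. -/
structure IsContinuum {Z : Type*} [TopologicalSpace Z] (K : Set Z) : Prop where
  isCompact : IsCompact K
  isConnected : IsConnected K

namespace IsContinuum

variable {Z Q : Type*} [TopologicalSpace Z] [TopologicalSpace Q]

theorem image {K : Set Z} (hK : IsContinuum K) {h : Z → Q} (hh : Continuous h) :
    IsContinuum (h '' K) :=
  ⟨hK.1.image hh, hK.2.image h hh.continuousOn⟩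

/-- The preimage of a continuum under a map with compact graph and connected fibers. -/
theorem of_fibers [T2Space Z] {N : Set (Z × Q)} (hN : IsCompact N)
    (hK : IsConnected (Prod.fst '' N))
    (hfib : ∀ z ∈ Prod.fst '' N, IsPreconnected {q | (z, q) ∈ N}) : IsContinuum N := by
  refine ⟨hN, hK.nonempty.of_image, ?_⟩
  rw [isPreconnected_closed_iff]
  intro A B hA hB hAB hnA hnB
  have key := isPreconnected_closed_iff.1 hK.isPreconnected (Prod.fst '' (N ∩ A))
    (Prod.fst '' (N ∩ B)) ((hN.inter_right hA).image continuous_fst).isClosed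
    ((hN.inter_right hB).image continuous_fst).isClosed
    (by
      rintro _ ⟨p, hp, rfl⟩
      rcases hAB hp with h | h
      · exact Or.inl ⟨p, ⟨hp, h⟩, rfl⟩
      · exact Or.inr ⟨p, ⟨hp, h⟩, rfl⟩)
    (by
      obtain ⟨p, hp⟩ := hnA
      exact ⟨p.1, ⟨p, hp.1, rfl⟩, p, hp, rfl⟩)
    (by
      obtain ⟨p, hp⟩ := hnB
      exact ⟨p.1, ⟨p, hp.1, rfl⟩, p, hp, rfl⟩)
  obtain ⟨z, hz, ⟨⟨_, a⟩, ha, rfl⟩, ⟨⟨_, b⟩, hb, rfl⟩⟩ := key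
  have hc : ∀ z : Z, Continuous fun q : Q => (z, q) := fun z => by fun_prop
  obtain ⟨q, hq, hq'⟩ := isPreconnected_closed_iff.1 (hfib _ hz) _ _ (hA.preimage (hc _))
    (hB.preimage (hc _)) (fun q hq => hAB hq) ⟨a, ha⟩ ⟨b, hb⟩
  exact ⟨_, hq, hq'⟩

end IsContinuum

section Lifts

variable {Z Q : Type*} [TopologicalSpace Z] [TopologicalSpace Q]

/-- Over every continuum `L`, the relation `R` contains a continuum whose projection to `L`
is surjective and weakly confluent. -/
def HasLifts (R : Set (Z × Q)) : Prop :=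
  ∀ L, IsContinuum L → ∃ M ⊆ R, IsContinuum M ∧ Prod.fst '' M = L ∧
    ∀ K ⊆ L, IsContinuum K → ∃ N ⊆ M, IsContinuum N ∧ Prod.fst '' N = K

theorem hasLifts_graph {h : Z → Q} (hh : Continuous h) : HasLifts {p : Z × Q | p.2 = h p.1} := by
  have hσ : Continuous fun z => (z, h z) := by fun_prop
  refine fun L hL => ⟨(fun z => (z, h z)) '' L, ?_, hL.image hσ, ?_,
    fun K hKL hK => ⟨(fun z => (z, h z)) '' K, Set.image_mono hKL, hK.image hσ, ?_⟩⟩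
  · rintro _ ⟨z, -, rfl⟩
    rfl
  all_goals rw [Set.image_image]; simp

/-- A closed relation with values in a compact set and nonempty connected fibers. -/
theorem hasLifts_of_fibers [T2Space Z] {R : Set (Z × Q)} {W : Set Q} (hW : IsCompact W)
    (hR : IsClosed R) (hRW : ∀ p ∈ R, p.2 ∈ W) (hfib : ∀ z, IsConnected {q | (z, q) ∈ R}) :
    HasLifts R := by
  have himg : ∀ K : Set Z, Prod.fst '' (R ∩ Prod.fst ⁻¹' K) = K := by
    intro K
    ext z
    constructor
    · rintro ⟨p, hp, rfl⟩
      exact hp.2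
    · intro hz
      obtain ⟨q, hq⟩ := (hfib z).nonempty
      exact ⟨(z, q), ⟨hq, hz⟩, rfl⟩
  have hcont : ∀ K : Set Z, IsContinuum K → IsContinuum (R ∩ Prod.fst ⁻¹' K) := by
    intro K hK
    refine IsContinuum.of_fibers ?_ ((himg K).symm ▸ hK.2) ?_
    · refine (hK.1.prod hW).of_isClosed_subset
        (hR.inter (hK.1.isClosed.preimage continuous_fst)) ?_
      exact fun p hp => ⟨hp.2, hRW p hp.1⟩
    · intro z hz
      rw [himg] at hz
      convert (hfib z).isPreconnected using 1
      ext q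
      simp [hz]
  exact fun L hL => ⟨_, Set.inter_subset_left, hcont L hL, himg L, fun K hKL hK =>
    ⟨_, Set.inter_subset_inter_right _ (Set.preimage_mono hKL), hcont K hK, himg K⟩⟩

/-- The relation consisting of three partial graphs, glued along two level sets of `f`. -/
def foldRel (f : Z → ℝ) (h₀ h₁ h₂ : Z → Q) : Set (Z × Q) :=
  {p | f p.1 ≤ 2 ∧ p.2 = h₀ p.1 ∨ (1 ≤ f p.1 ∧ f p.1 ≤ 2) ∧ p.2 = h₁ p.1 ∨
    1 ≤ f p.1 ∧ p.2 = h₂ p.1}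

section Fold

variable {f : Z → ℝ} {h₀ h₁ h₂ : Z → Q}

theorem isClosed_foldRel [T2Space Q] (hf : Continuous f) (c₀ : Continuous h₀)
    (c₁ : Continuous h₁) (c₂ : Continuous h₂) : IsClosed (foldRel f h₀ h₁ h₂) := by
  have hf' : Continuous fun p : Z × Q => f p.1 := by fun_prop
  refine ((isClosed_le hf' continuous_const).inter
    (isClosed_eq continuous_snd (by fun_prop))).union
    ((((isClosed_le continuous_const hf').inter (isClosed_le hf' continuous_const)).inter
    (isClosed_eq continuous_snd (by fun_prop))).union
    ((isClosed_le continuous_const hf').inter (isClosed_eq continuous_snd (by fun_prop))))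

theorem isCompact_foldRel_inter [T2Space Z] [T2Space Q] (hf : Continuous f) (c₀ : Continuous h₀)
    (c₁ : Continuous h₁) (c₂ : Continuous h₂) {K : Set Z} (hK : IsCompact K) :
    IsCompact (foldRel f h₀ h₁ h₂ ∩ Prod.fst ⁻¹' K) := by
  refine ((hK.image (show Continuous fun z => (z, h₀ z) by fun_prop)).union
    ((hK.image (show Continuous fun z => (z, h₁ z) by fun_prop)).union
    (hK.image (show Continuous fun z => (z, h₂ z) by fun_prop)))).of_isClosed_subset
    ((isClosed_foldRel hf c₀ c₁ c₂).inter (hK.isClosed.preimage continuous_fst)) ?_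
  rintro ⟨z, q⟩ ⟨(⟨-, h⟩ | ⟨-, h⟩ | ⟨-, h⟩), hz⟩ <;> simp only at h <;> subst h
  · exact Or.inl ⟨z, hz, rfl⟩
  · exact Or.inr (Or.inl ⟨z, hz, rfl⟩)
  · exact Or.inr (Or.inr ⟨z, hz, rfl⟩)

/-- The parity argument: of two complementary closed pieces of the folded preimage of `K`,
the one containing a point with a one-point fiber projects onto `K`. -/
theorem subset_image_of_foldRel_subset (hf : Continuous f) (c₀ : Continuous h₀)
    (c₁ : Continuous h₁) (c₂ : Continuous h₂) (g₁ : ∀ z, f z = 1 → h₁ z = h₂ z)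
    (g₂ : ∀ z, f z = 2 → h₀ z = h₁ z) {K : Set Z} (hK : IsPreconnected K)
    {A B : Set (Z × Q)} (hA : IsClosed A) (hB : IsClosed B) (hdisj : Disjoint A B)
    (hcov : foldRel f h₀ h₁ h₂ ∩ Prod.fst ⁻¹' K ⊆ A ∪ B) {p : Z × Q}
    (hp : p ∈ foldRel f h₀ h₁ h₂) (hpK : p.1 ∈ K) (hpA : p ∈ A)
    (hpf : f p.1 < 1 ∨ 2 < f p.1) : K ⊆ Prod.fst '' A := by
  let S : Set (Z × Q) → Set (Z × Q) → Set Z := fun A B =>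
    {z | f z ≤ 1 ∧ (z, h₀ z) ∈ A} ∪ {z | 2 ≤ f z ∧ (z, h₂ z) ∈ A} ∪
    {z | (1 ≤ f z ∧ f z ≤ 2) ∧
      ((z, h₀ z) ∈ A ∧ (z, h₁ z) ∈ A ∧ (z, h₂ z) ∈ A ∨
       (z, h₀ z) ∈ A ∧ (z, h₁ z) ∈ B ∧ (z, h₂ z) ∈ B ∨
       (z, h₀ z) ∈ B ∧ (z, h₁ z) ∈ A ∧ (z, h₂ z) ∈ B ∨
       (z, h₀ z) ∈ B ∧ (z, h₁ z) ∈ B ∧ (z, h₂ z) ∈ A)}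
  have hS : ∀ A B : Set (Z × Q), IsClosed A → IsClosed B → IsClosed (S A B) := by
    intro A B hA hB
    have p₀ : ∀ A : Set (Z × Q), IsClosed A → IsClosed {z | (z, h₀ z) ∈ A} :=
      fun A hA => hA.preimage (show Continuous fun z => (z, h₀ z) by fun_prop)
    have p₁ : ∀ A : Set (Z × Q), IsClosed A → IsClosed {z | (z, h₁ z) ∈ A} :=
      fun A hA => hA.preimage (show Continuous fun z => (z, h₁ z) by fun_prop)
    have p₂ : ∀ A : Set (Z × Q), IsClosed A → IsClosed {z | (z, h₂ z) ∈ A} :=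
      fun A hA => hA.preimage (show Continuous fun z => (z, h₂ z) by fun_prop)
    have l : ∀ r : ℝ, IsClosed {z | f z ≤ r} := fun r => isClosed_le hf continuous_const
    have l' : ∀ r : ℝ, IsClosed {z | r ≤ f z} := fun r => isClosed_le continuous_const hf
    exact (((l 1).inter (p₀ A hA)).union ((l' 2).inter (p₂ A hA))).union
      (((l' 1).inter (l 2)).inter
      (((p₀ A hA).inter ((p₁ A hA).inter (p₂ A hA))).union
      (((p₀ A hA).inter ((p₁ B hB).inter (p₂ B hB))).union
      (((p₀ B hB).inter ((p₁ A hA).inter (p₂ B hB))).union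
      ((p₀ B hB).inter ((p₁ B hB).inter (p₂ A hA)))))))
  have hd : ∀ q, q ∈ A → q ∈ B → False := fun q h h' => Set.disjoint_left.1 hdisj h h'
  have m₀ : ∀ z ∈ K, f z ≤ 2 → (z, h₀ z) ∈ A ∨ (z, h₀ z) ∈ B :=
    fun z hz h => hcov ⟨Or.inl ⟨h, rfl⟩, hz⟩
  have m₁ : ∀ z ∈ K, 1 ≤ f z → f z ≤ 2 → (z, h₁ z) ∈ A ∨ (z, h₁ z) ∈ B :=
    fun z hz h h' => hcov ⟨Or.inr (Or.inl ⟨⟨h, h'⟩, rfl⟩), hz⟩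
  have m₂ : ∀ z ∈ K, 1 ≤ f z → (z, h₂ z) ∈ A ∨ (z, h₂ z) ∈ B :=
    fun z hz h => hcov ⟨Or.inr (Or.inr ⟨h, rfl⟩), hz⟩
  have hKS : K ⊆ S A B ∪ S B A := by
    intro z hz
    simp only [S, Set.mem_union, Set.mem_ofPred_eq]
    have := m₀ z hz
    have := m₁ z hz
    have := m₂ z hz
    grind
  have hpS : p.1 ∈ S A B := by
    obtain ⟨z, q⟩ := p
    simp only [S, Set.mem_union, Set.mem_ofPred_eq]
    simp only [foldRel, Set.mem_ofPred_eq] at hp hpf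
    rcases hpf with h | h
    · rcases hp with ⟨-, rfl⟩ | hp | hp
      · exact Or.inl (Or.inl ⟨h.le, hpA⟩)
      · linarith [hp.1.1]
      · linarith [hp.1]
    · rcases hp with hp | hp | ⟨-, rfl⟩
      · linarith [hp.1]
      · linarith [hp.1.2]
      · exact Or.inl (Or.inr ⟨h.le, hpA⟩)
  have hempty : ∀ z ∈ K, z ∈ S A B → z ∈ S B A → False := by
    intro z hz hSA hSB
    have d₀ := hd (z, h₀ z)
    have d₁ := hd (z, h₁ z)
    have d₂ := hd (z, h₂ z)
    simp only [S, Set.mem_union, Set.mem_ofPred_eq] at hSA hSB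
    have := g₁ z
    have := g₂ z
    grind
  intro z hz
  have hzS : z ∈ S A B := by
    by_contra hzS
    obtain ⟨y, hy, hyA, hyB⟩ := isPreconnected_closed_iff.1 hK _ _ (hS A B hA hB)
      (hS B A hB hA) hKS ⟨p.1, hpK, hpS⟩ ⟨z, hz, (hKS hz).resolve_left hzS⟩
    exact hempty y hy hyA hyB
  simp only [S, Set.mem_union, Set.mem_ofPred_eq] at hzS
  have : ∀ q, (z, q) ∈ A → z ∈ Prod.fst '' A := fun q hq => ⟨_, hq, rfl⟩
  grind

theorem image_connectedComponentIn_foldRel [T2Space Z] [T2Space Q] (hf : Continuous f)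
    (c₀ : Continuous h₀) (c₁ : Continuous h₁) (c₂ : Continuous h₂)
    (g₁ : ∀ z, f z = 1 → h₁ z = h₂ z) (g₂ : ∀ z, f z = 2 → h₀ z = h₁ z) {K : Set Z}
    (hK : IsContinuum K) {p : Z × Q} (hp : p ∈ foldRel f h₀ h₁ h₂) (hpK : p.1 ∈ K)
    (hpf : f p.1 < 1 ∨ 2 < f p.1) :
    Prod.fst '' connectedComponentIn (foldRel f h₀ h₁ h₂ ∩ Prod.fst ⁻¹' K) p = K := by
  set P := foldRel f h₀ h₁ h₂ ∩ Prod.fst ⁻¹' K with hP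
  have hPc : IsCompact P := isCompact_foldRel_inter hf c₀ c₁ c₂ hK.1
  have hpP : p ∈ P := ⟨hp, hpK⟩
  have : CompactSpace P := isCompact_iff_compactSpace.1 hPc
  refine Set.Subset.antisymm ?_ fun z hz => ?_
  · rintro _ ⟨q, hq, rfl⟩
    exact (connectedComponentIn_subset P p hq).2
  rw [connectedComponentIn_eq_image hpP, connectedComponent_eq_iInter_isClopen]
  have hne : (⋂ s : {s : Set P // IsClopen s ∧ (⟨p, hpP⟩ : P) ∈ s},
      s.1 ∩ {y : P | y.1.1 = z}).Nonempty := by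
    have hfz : IsClosed {y : P | y.1.1 = z} := isClosed_eq (by fun_prop) continuous_const
    have : Nonempty {s : Set P // IsClopen s ∧ (⟨p, hpP⟩ : P) ∈ s} :=
      ⟨⟨Set.univ, isClopen_univ, trivial⟩⟩
    refine IsCompact.nonempty_iInter_of_directed_nonempty_isCompact_isClosed _ ?_ ?_ ?_ ?_
    · intro s t
      refine ⟨⟨s.1 ∩ t.1, s.2.1.inter t.2.1, s.2.2, t.2.2⟩, ?_, ?_⟩
      · exact fun y hy => ⟨hy.1.1, hy.2⟩
      · exact fun y hy => ⟨hy.1.2, hy.2⟩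
    · rintro ⟨s, hs, hps⟩
      have key := subset_image_of_foldRel_subset hf c₀ c₁ c₂ g₁ g₂ hK.2.isPreconnected
        (A := Subtype.val '' s) (B := Subtype.val '' sᶜ)
        (hs.1.isCompact.image continuous_subtype_val).isClosed
        (hs.compl.1.isCompact.image continuous_subtype_val).isClosed
        ((Set.disjoint_image_iff Subtype.val_injective).2 disjoint_compl_right)
        (by
          rw [← Set.image_union, Set.union_compl_self, Set.image_univ, Subtype.range_coe])
        hp hpK ⟨_, hps, rfl⟩ hpf hz
      obtain ⟨_, ⟨y, hy, rfl⟩, hyz⟩ := key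
      exact ⟨y, hy, hyz⟩
    · exact fun s => (s.2.1.1.inter hfz).isCompact
    · exact fun s => s.2.1.1.inter hfz
  obtain ⟨y, hy⟩ := hne
  rw [Set.mem_iInter] at hy
  refine ⟨y, ⟨y, Set.mem_iInter.2 fun s => (hy s).1, rfl⟩, ?_⟩
  exact (hy ⟨Set.univ, isClopen_univ, trivial⟩).2

theorem isContinuum_connectedComponentIn {P : Set Z} [T2Space Z] (hP : IsCompact P) {p : Z}
    (hp : p ∈ P) : IsContinuum (connectedComponentIn P p) :=
  ⟨by
    have : CompactSpace P := isCompact_iff_compactSpace.1 hP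
    rw [connectedComponentIn_eq_image hp]
    exact isClosed_connectedComponent.isCompact.image continuous_subtype_val,
    isConnected_connectedComponentIn_iff.2 hp⟩

theorem hasLifts_foldRel [T2Space Z] [T2Space Q] (hf : Continuous f)
    (c₀ : Continuous h₀) (c₁ : Continuous h₁) (c₂ : Continuous h₂)
    (g₁ : ∀ z, f z = 1 → h₁ z = h₂ z) (g₂ : ∀ z, f z = 2 → h₀ z = h₁ z) :
    HasLifts (foldRel f h₀ h₁ h₂) := by
  have hgraph : ∀ h : Z → Q, ∀ K : Set Z,
      Prod.fst '' ((fun z => (z, h z)) '' K) = K := fun h K => by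
    rw [Set.image_image]; simp
  have hfst : ∀ z, (f z < 1 ∨ 2 < f z) → ∃ q, (z, q) ∈ foldRel f h₀ h₁ h₂ := by
    rintro z (h | h)
    · exact ⟨h₀ z, Or.inl ⟨by simp only; linarith, rfl⟩⟩
    · exact ⟨h₂ z, Or.inr (Or.inr ⟨by simp only; linarith, rfl⟩)⟩
  have huniq : ∀ z q q', (f z < 1 ∨ 2 < f z) → (z, q) ∈ foldRel f h₀ h₁ h₂ →
      (z, q') ∈ foldRel f h₀ h₁ h₂ → q = q' := by
    intro z q q' h hq hq'
    simp only [foldRel, Set.mem_ofPred_eq] at hq hq'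
    grind
  intro L hL
  by_cases hex : ∃ z ∈ L, f z < 1 ∨ 2 < f z
  · obtain ⟨x, hxL, hx⟩ := hex
    obtain ⟨q, hq⟩ := hfst x hx
    have hPc := isCompact_foldRel_inter hf c₀ c₁ c₂ hL.1
    have hsurj := image_connectedComponentIn_foldRel hf c₀ c₁ c₂ g₁ g₂ hL hq hxL hx
    set M := connectedComponentIn (foldRel f h₀ h₁ h₂ ∩ Prod.fst ⁻¹' L) (x, q) with hM
    have habs : ∀ N ⊆ foldRel f h₀ h₁ h₂ ∩ Prod.fst ⁻¹' L, IsPreconnected N →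
        ∀ y ∈ N, y ∈ M → N ⊆ M := by
      intro N hN hNc y hy hyM
      rw [hM, connectedComponentIn_eq hyM]
      exact hNc.subset_connectedComponentIn hy hN
    refine ⟨M, (connectedComponentIn_subset _ _).trans Set.inter_subset_left,
      isContinuum_connectedComponentIn hPc ⟨hq, hxL⟩, hsurj, fun K hKL hK => ?_⟩
    by_cases hexK : ∃ z ∈ K, f z < 1 ∨ 2 < f z
    · obtain ⟨y, hyK, hy⟩ := hexK
      obtain ⟨r, hr⟩ := hfst y hy
      refine ⟨connectedComponentIn (foldRel f h₀ h₁ h₂ ∩ Prod.fst ⁻¹' K) (y, r), ?_,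
        isContinuum_connectedComponentIn (isCompact_foldRel_inter hf c₀ c₁ c₂ hK.1) ⟨hr, hyK⟩,
        image_connectedComponentIn_foldRel hf c₀ c₁ c₂ g₁ g₂ hK hr hyK hy⟩
      refine habs _ ((connectedComponentIn_subset _ _).trans
        (Set.inter_subset_inter_right _ (Set.preimage_mono hKL)))
        isPreconnected_connectedComponentIn (y, r) (mem_connectedComponentIn ⟨hr, hyK⟩) ?_
      have hyL := hKL hyK
      rw [← hsurj] at hyL
      obtain ⟨⟨y', s⟩, hs, hys⟩ := hyL
      obtain rfl : y = y' := hys.symm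
      rwa [huniq _ r s hy hr (connectedComponentIn_subset _ _ hs).1]
    · push Not at hexK
      obtain ⟨y, hyK⟩ := hK.2.nonempty
      have hyL := hKL hyK
      rw [← hsurj] at hyL
      obtain ⟨⟨y', s⟩, hs, hys⟩ := hyL
      obtain rfl : y = y' := hys.symm
      have hsec : ∃ h : Z → Q, Continuous h ∧ s = h y ∧
          ∀ z ∈ K, (z, h z) ∈ foldRel f h₀ h₁ h₂ := by
        rcases (connectedComponentIn_subset _ _ hs).1 with h | h | h
        · exact ⟨h₀, c₀, h.2, fun z hz => Or.inl ⟨(hexK z hz).2, rfl⟩⟩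
        · exact ⟨h₁, c₁, h.2, fun z hz => Or.inr (Or.inl ⟨hexK z hz, rfl⟩)⟩
        · exact ⟨h₂, c₂, h.2, fun z hz => Or.inr (Or.inr ⟨(hexK z hz).1, rfl⟩)⟩
      obtain ⟨h, hc, rfl, hmem⟩ := hsec
      have hN := hK.image (show Continuous fun z => (z, h z) by fun_prop)
      refine ⟨_, habs _ ?_ hN.2.isPreconnected (y, h y) ⟨y, hyK, rfl⟩ hs, hN, hgraph h K⟩
      rintro _ ⟨z, hz, rfl⟩
      exact ⟨hmem z hz, hKL hz⟩
  · push Not at hex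
    refine ⟨(fun z => (z, h₀ z)) '' L, ?_, hL.image (by fun_prop), hgraph h₀ L,
      fun K hKL hK => ⟨(fun z => (z, h₀ z)) '' K, Set.image_mono hKL, hK.image (by fun_prop),
        hgraph h₀ K⟩⟩
    rintro _ ⟨z, hz, rfl⟩
    exact Or.inl ⟨(hex z hz).2, rfl⟩

end Fold

end Lifts

section UltraLimit

open Filter Topology

variable {I Z : Type*} [TopologicalSpace Z]

/-- The limit of a family of sets along a filter. -/
def limSet (𝒰 : Filter I) (L : I → Set Z) : Set Z :=
  {z | ∀ U ∈ 𝓝 z, ∀ᶠ i in 𝒰, (L i ∩ U).Nonempty}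

theorem limSet_mono {𝒰 : Filter I} {L L' : I → Set Z} (h : ∀ i, L i ⊆ L' i) :
    limSet 𝒰 L ⊆ limSet 𝒰 L' := fun _ hz U hU =>
  (hz U hU).mono fun i hi => hi.mono (Set.inter_subset_inter_left _ (h i))

theorem limSet_subset_of_eventually {𝒰 : Filter I} [𝒰.NeBot] {L : I → Set Z} {F : Set Z}
    (hF : IsClosed F) (h : ∀ᶠ i in 𝒰, L i ⊆ F) : limSet 𝒰 L ⊆ F := by
  intro z hz
  by_contra hzF
  obtain ⟨i, ⟨y, hy, hyF⟩, hi⟩ := ((hz Fᶜ (hF.isOpen_compl.mem_nhds hzF)).and h).exists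
  exact hyF (hi hy)

theorem isClosed_limSet {𝒰 : Filter I} {L : I → Set Z} : IsClosed (limSet 𝒰 L) := by
  rw [← isOpen_compl_iff, isOpen_iff_mem_nhds]
  intro z hz
  simp only [limSet, Set.mem_compl_iff, Set.mem_ofPred_eq, not_forall] at hz
  obtain ⟨U, hU, h⟩ := hz
  filter_upwards [eventually_mem_nhds_iff.2 hU] with y hy hyL
  exact h (hyL U hy)

theorem exists_mem_limSet {𝒰 : Ultrafilter I} {L : I → Set Z} {C : Set Z} (hC : IsCompact C)
    {x : I → Z} (hx : ∀ᶠ i in 𝒰, x i ∈ L i) (hxC : ∀ i, x i ∈ C) :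
    ∃ z ∈ limSet (𝒰 : Filter I) L, Tendsto x 𝒰 (𝓝 z) := by
  obtain ⟨z, -, hz⟩ := hC.ultrafilter_le_nhds (𝒰.map x)
    (le_principal_iff.2 (Filter.Eventually.of_forall hxC :))
  exact ⟨z, fun U hU => (hx.and (hz hU)).mono fun i hi => ⟨x i, hi⟩, hz⟩

theorem isContinuum_limSet [T2Space Z] {𝒰 : Ultrafilter I} {L : I → Set Z} {C : Set Z}
    (hC : IsCompact C) (hL : ∀ i, IsContinuum (L i)) (hLC : ∀ i, L i ⊆ C) :
    IsContinuum (limSet (𝒰 : Filter I) L) := by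
  have hc : IsCompact (limSet (𝒰 : Filter I) L) := hC.of_isClosed_subset isClosed_limSet
    (limSet_subset_of_eventually hC.isClosed (Filter.Eventually.of_forall hLC))
  refine ⟨hc, ?_, ?_⟩
  · choose x hx using fun i => (hL i).2.nonempty
    obtain ⟨z, hz, -⟩ := exists_mem_limSet (𝒰 := 𝒰) hC (Filter.Eventually.of_forall hx)
      fun i => hLC i (hx i)
    exact ⟨z, hz⟩
  · rw [isPreconnected_closed_iff]
    intro A B hA hB hAB ⟨a, ha, haA⟩ ⟨b, hb, hbB⟩
    by_contra hne
    have hdis : Disjoint (limSet (𝒰 : Filter I) L ∩ A) (limSet (𝒰 : Filter I) L ∩ B) := by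
      rw [Set.disjoint_left]
      exact fun z hz hz' => hne ⟨z, hz.1, hz.2, hz'.2⟩
    obtain ⟨U, V, hU, hV, hAU, hBV, hUV⟩ :=
      SeparatedNhds.of_isCompact_isCompact (hc.inter_right hA) (hc.inter_right hB) hdis
    have hsub : ∀ᶠ i in (𝒰 : Filter I), L i ⊆ U ∪ V := by
      by_contra hcon
      rw [← Ultrafilter.eventually_not] at hcon
      have : ∀ i, ∃ x ∈ L i, ¬ L i ⊆ U ∪ V → x ∉ U ∪ V := by
        intro i
        by_cases h : L i ⊆ U ∪ V
        · obtain ⟨x, hx⟩ := (hL i).2.nonempty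
          exact ⟨x, hx, fun h' => absurd h h'⟩
        · obtain ⟨x, hx, hx'⟩ := Set.not_subset.1 h
          exact ⟨x, hx, fun _ => hx'⟩
      choose x hx hx' using this
      obtain ⟨z, hz, hlim⟩ := exists_mem_limSet (𝒰 := 𝒰) hC (Filter.Eventually.of_forall hx)
        fun i => hLC i (hx i)
      have hzUV : z ∈ U ∪ V := (hAB hz).imp (fun h => hAU ⟨hz, h⟩) fun h => hBV ⟨hz, h⟩
      obtain ⟨i, hi, hi'⟩ :=
        (hcon.and (hlim.eventually ((hU.union hV).mem_nhds hzUV))).exists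
      exact hx' i hi hi'
    obtain ⟨i, ⟨hi, hiU⟩, hiV⟩ := ((hsub.and (ha U (hU.mem_nhds (hAU ⟨ha, haA⟩)))).and
      (hb V (hV.mem_nhds (hBV ⟨hb, hbB⟩)))).exists
    obtain ⟨y, -, hy⟩ := (hL i).2.isPreconnected U V hU hV hi hiU hiV
    exact Set.disjoint_left.1 hUV hy.1 hy.2

theorem image_limSet {X : Type*} [TopologicalSpace X] [T2Space X] {𝒰 : Ultrafilter I}
    {L : I → Set Z} {C : Set Z} (hC : IsCompact C) (hLC : ∀ i, L i ⊆ C) {π : Z → X}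
    (hπ : Continuous π) {K : Set X} (hK : IsClosed K) (h : ∀ i, π '' L i = K) :
    π '' limSet (𝒰 : Filter I) L = K := by
  refine Set.Subset.antisymm ?_ fun x hx => ?_
  · rw [Set.image_subset_iff]
    exact limSet_subset_of_eventually (hK.preimage hπ)
      (Filter.Eventually.of_forall fun i => Set.image_subset_iff.1 (h i).subset)
  · have : ∀ i, ∃ y ∈ L i, π y = x := fun i => (h i).symm.subset hx
    choose y hy hyx using this
    obtain ⟨z, hz, hlim⟩ := exists_mem_limSet (𝒰 := 𝒰) hC (Filter.Eventually.of_forall hy)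
      fun i => hLC i (hy i)
    refine ⟨z, hz, tendsto_nhds_unique ((hπ.tendsto z).comp hlim) ?_⟩
    exact tendsto_const_nhds.congr fun i => (hyx i).symm

end UltraLimit

section Tower

variable {X T Q : Type*} [TopologicalSpace X] [TopologicalSpace Q]

theorem exists_continuum_finset [CompactSpace X] [ConnectedSpace X]
    {W : Set Q} {q₀ : Q} (hq₀ : q₀ ∈ W) (size : T → ℕ)
    {R : T → Set ((X × (T → Q)) × Q)} (hRW : ∀ t, ∀ p ∈ R t, p.2 ∈ W)
    (hlift : ∀ t, HasLifts (R t))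
    (hdep : ∀ t x z z' q, (∀ s, size s < size t → z s = z' s) →
      ((x, z), q) ∈ R t → ((x, z'), q) ∈ R t) (F : Finset T) :
    ∃ L : Set X → Set (X × (T → Q)), (∀ z ∈ L Set.univ, ∀ t ∈ F, (z, z.2 t) ∈ R t) ∧
      ∀ K, IsContinuum K → IsContinuum (L K) ∧ Prod.fst '' L K = K ∧ L K ⊆ L Set.univ ∧
        ∀ z ∈ L K, ∀ t, z.2 t ∈ W := by
  classical
  induction F using Finset.induction_on_max_value (f := size) with
  | empty =>
    have hc : Continuous fun x : X => (x, fun _ : T => q₀) := by fun_prop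
    refine ⟨fun K => (fun x => (x, fun _ => q₀)) '' K, by simp, fun K hK =>
      ⟨hK.image hc, by rw [Set.image_image]; simp, Set.image_mono (Set.subset_univ K), ?_⟩⟩
    rintro _ ⟨x, -, rfl⟩ t
    exact hq₀
  | insert t F htF hmax ih =>
    obtain ⟨L, hLR, hL⟩ := ih
    have huniv : IsContinuum (Set.univ : Set X) := ⟨isCompact_univ, isConnected_univ⟩
    obtain ⟨M, hMR, hM, hML, hwc⟩ := hlift t _ (hL _ huniv).1
    let g : (X × (T → Q)) × Q → X × (T → Q) := fun p => (p.1.1, Function.update p.1.2 t p.2)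
    have hg : Continuous g := by fun_prop
    have hgW : ∀ p ∈ M, ∀ s, (g p).2 s ∈ W := by
      intro p hp s
      by_cases hs : s = t
      · subst hs
        simpa [g] using hRW s p (hMR hp)
      · have : p.1 ∈ L Set.univ := hML ▸ ⟨p, hp, rfl⟩
        simpa [g, Function.update_of_ne hs] using (hL _ huniv).2.2.2 _ this s
    have hN : ∀ K, IsContinuum K → ∃ N ⊆ M, IsContinuum N ∧ Prod.fst '' N = L K ∧
        (K = Set.univ → N = M) := by
      intro K hK
      by_cases h : K = Set.univ
      · subst h
        exact ⟨M, subset_rfl, hM, hML, fun _ => rfl⟩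
      · obtain ⟨N, hNM, hN, hNL⟩ := hwc _ (hL K hK).2.2.1 (hL K hK).1
        exact ⟨N, hNM, hN, hNL, fun h' => absurd h' h⟩
    choose! N hNM hNc hNL hNu using hN
    refine ⟨fun K => g '' N K, ?_, fun K hK => ⟨(hNc K hK).image hg, ?_, ?_, ?_⟩⟩
    · simp only [hNu _ huniv rfl]
      rintro _ ⟨⟨⟨x, z⟩, q⟩, hp, rfl⟩ s hs
      have hz : (x, z) ∈ L Set.univ := hML ▸ ⟨_, hp, rfl⟩
      rcases Finset.mem_insert.1 hs with rfl | hsF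
      · simp only [g, Function.update_self]
        refine hdep s x z _ q (fun r hr => ?_) (hMR hp)
        rw [Function.update_of_ne]
        rintro rfl
        exact lt_irrefl _ hr
      · have hst : s ≠ t := fun h => htF (h ▸ hsF)
        simp only [g, Function.update_of_ne hst]
        refine hdep s x z _ _ (fun r hr => ?_) (hLR _ hz s hsF)
        rw [Function.update_of_ne]
        rintro rfl
        exact absurd (hmax s hsF) (not_le.2 hr)
    · conv_rhs => rw [← (hL K hK).2.1, ← hNL K hK, Set.image_image]
      rw [Set.image_image]
    · simp only [hNu _ huniv rfl]
      exact Set.image_mono (hNM K hK)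
    · rintro _ ⟨p, hp, rfl⟩
      exact hgW p (hNM K hK hp)

/-- Constraints on the coordinates of `X × (T → Q)` that depend on coordinates of smaller size
only and that can be lifted one at a time can be satisfied simultaneously on a continuum with
weakly confluent projection onto `X`. -/
theorem exists_continuum_forall [CompactSpace X] [T2Space X] [ConnectedSpace X] [T2Space Q]
    {W : Set Q} (hW : IsCompact W) {q₀ : Q} (hq₀ : q₀ ∈ W) (size : T → ℕ)
    {R : T → Set ((X × (T → Q)) × Q)} (hR : ∀ t, IsClosed (R t))
    (hRW : ∀ t, ∀ p ∈ R t, p.2 ∈ W) (hlift : ∀ t, HasLifts (R t))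
    (hdep : ∀ t x z z' q, (∀ s, size s < size t → z s = z' s) →
      ((x, z), q) ∈ R t → ((x, z'), q) ∈ R t) :
    ∃ M : Set (X × (T → Q)), IsContinuum M ∧ Prod.fst '' M = Set.univ ∧
      (∀ z ∈ M, ∀ t, (z, z.2 t) ∈ R t) ∧
      ∀ K : Set X, IsContinuum K → ∃ N ⊆ M, IsContinuum N ∧ Prod.fst '' N = K := by
  classical
  choose L hLR hL using exists_continuum_finset hq₀ size hRW hlift hdep
  have huniv : IsContinuum (Set.univ : Set X) := ⟨isCompact_univ, isConnected_univ⟩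
  let C : Set (X × (T → Q)) := Set.univ ×ˢ Set.univ.pi fun _ => W
  have hC : IsCompact C := isCompact_univ.prod (isCompact_univ_pi fun _ => hW)
  have hLC : ∀ K, IsContinuum K → ∀ F, L F K ⊆ C := fun K hK F z hz =>
    ⟨trivial, fun t _ => (hL F K hK).2.2.2 z hz t⟩
  let 𝒰 : Ultrafilter (Finset T) := Ultrafilter.of Filter.atTop
  have hcont : ∀ K, IsContinuum K → IsContinuum (limSet (𝒰 : Filter _) fun F => L F K) :=
    fun K hK => isContinuum_limSet hC (fun F => (hL F K hK).1) (hLC K hK)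
  have himg : ∀ K, IsContinuum K →
      Prod.fst '' limSet (𝒰 : Filter _) (fun F => L F K) = K := fun K hK =>
    image_limSet hC (hLC K hK) continuous_fst hK.1.isClosed fun F => (hL F K hK).2.1
  refine ⟨limSet (𝒰 : Filter _) fun F => L F Set.univ, hcont _ huniv, himg _ huniv, ?_,
    fun K hK => ⟨_, limSet_mono fun F => (hL F K hK).2.2.1, hcont K hK, himg K hK⟩⟩
  intro z hz t
  have hcl : IsClosed {z : X × (T → Q) | (z, z.2 t) ∈ R t} :=
    (hR t).preimage (by fun_prop)
  refine limSet_subset_of_eventually hcl ?_ hz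
  refine Ultrafilter.of_le _ ?_
  filter_upwards [Filter.eventually_ge_atTop {t}] with F hF y hy
  exact hLR F y hy t (hF (Finset.mem_singleton_self t))

end Tower

section Hexagon

/-- The boundary of a hexagon: the points of the unit cube with a coordinate equal to zero and
a coordinate equal to one. -/
def hexagon : Set (Fin 3 → ℝ) :=
  {q | (∀ i, 0 ≤ q i ∧ q i ≤ 1) ∧ (∃ i, q i = 0) ∧ ∃ i, q i = 1}

theorem isClosed_hexagon : IsClosed hexagon := by
  have h : ∀ r : ℝ, IsClosed {q : Fin 3 → ℝ | ∃ i, q i = r} := by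
    intro r
    rw [Set.ofPred_exists]
    exact isClosed_iUnion_of_finite fun i => isClosed_eq (by fun_prop) continuous_const
  suffices h' : IsClosed {q : Fin 3 → ℝ | ∀ i, 0 ≤ q i ∧ q i ≤ 1} from
    h'.inter ((h 0).inter (h 1))
  rw [Set.ofPred_forall]
  exact isClosed_iInter fun i => (isClosed_le continuous_const (continuous_apply i)).inter
    (isClosed_le (continuous_apply i) continuous_const)

theorem isConnected_hexagon : IsConnected hexagon := by
  let S : Fin 3 → Fin 3 → Set (Fin 3 → ℝ) := fun i j =>
    {q | (∀ k, 0 ≤ q k ∧ q k ≤ 1) ∧ q i = 0 ∧ q j = 1}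
  have hS : ∀ i j, IsPreconnected (S i j) := by
    intro i j
    refine Convex.isPreconnected ?_
    rintro x ⟨hx, hx0, hx1⟩ y ⟨hy, hy0, hy1⟩ a b ha hb hab
    refine ⟨fun k => ⟨?_, ?_⟩, ?_, ?_⟩ <;> simp only [Pi.add_apply, Pi.smul_apply, smul_eq_mul]
    · have := mul_nonneg ha (hx k).1
      have := mul_nonneg hb (hy k).1
      linarith
    · have := mul_le_mul_of_nonneg_left (hx k).2 ha
      have := mul_le_mul_of_nonneg_left (hy k).2 hb
      linarith
    · rw [hx0, hy0]
      ring
    · rw [hx1, hy1]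
      linarith
  have hunion : hexagon = S 0 1 ∪ S 0 2 ∪ S 1 2 ∪ S 1 0 ∪ S 2 0 ∪ S 2 1 := by
    ext q
    simp only [hexagon, S, Set.mem_ofPred_eq, Set.mem_union]
    constructor
    · rintro ⟨h, ⟨i, hi⟩, j, hj⟩
      have hij : i ≠ j := by
        rintro rfl
        linarith
      fin_cases i <;> fin_cases j <;> first | exact absurd rfl hij | (simp at hi hj; tauto)
    · rintro (((((h | h) | h) | h) | h) | h) <;> exact ⟨h.1, ⟨_, h.2.1⟩, _, h.2.2⟩
  refine ⟨⟨![0, 1, 1], ?_⟩, ?_⟩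
  · refine ⟨fun i => by fin_cases i <;> simp, ⟨0, rfl⟩, ⟨1, rfl⟩⟩
  rw [hunion]
  have hv : ∀ (v : Fin 3 → ℝ) (i j k : Fin 3), v i = 0 → v j = 1 → v k = 0 ∨ v k = 1 →
      (∀ l, l = i ∨ l = j ∨ l = k) → v ∈ S i j := by
    refine fun v i j k hi hj hk h => ⟨fun l => ?_, hi, hj⟩
    rcases h l with rfl | rfl | rfl
    · simp [hi]
    · simp [hj]
    · rcases hk with hk | hk <;> simp [hk]
  have h₁ := (hS 0 1).union ![0, 1, 1] (hv _ _ _ 2 rfl rfl (Or.inr rfl) (by decide))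
    (hv _ _ _ 1 rfl rfl (Or.inr rfl) (by decide)) (hS 0 2)
  have h₂ := h₁.union ![0, 0, 1] (Or.inr (hv _ _ _ 1 rfl rfl (Or.inl rfl) (by decide)))
    (hv _ _ _ 0 rfl rfl (Or.inl rfl) (by decide)) (hS 1 2)
  have h₃ := h₂.union ![1, 0, 1] (Or.inr (hv _ _ _ 0 rfl rfl (Or.inr rfl) (by decide)))
    (hv _ _ _ 2 rfl rfl (Or.inr rfl) (by decide)) (hS 1 0)
  have h₄ := h₃.union ![1, 0, 0] (Or.inr (hv _ _ _ 2 rfl rfl (Or.inl rfl) (by decide)))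
    (hv _ _ _ 1 rfl rfl (Or.inl rfl) (by decide)) (hS 2 0)
  refine h₄.union ![0, 1, 0] (Or.inl (Or.inl (Or.inl (Or.inl ?_))))
    (hv _ _ _ 0 rfl rfl (Or.inl rfl) (by decide)) (hS 2 1)
  exact hv _ _ _ 2 rfl rfl (Or.inl rfl) (by decide)

end Hexagon

section Blow

/-- The least coordinate of a vector. -/
noncomputable def minCoord (v : Fin 3 → ℝ) : ℝ := min (v 0) (min (v 1) (v 2))

/-- The largest coordinate of a vector. -/
noncomputable def maxCoord (v : Fin 3 → ℝ) : ℝ := max (v 0) (max (v 1) (v 2))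

theorem continuous_minCoord : Continuous minCoord := by
  unfold minCoord
  fun_prop

theorem continuous_maxCoord : Continuous maxCoord := by
  unfold maxCoord
  fun_prop

theorem minCoord_le (v : Fin 3 → ℝ) (i : Fin 3) : minCoord v ≤ v i := by
  fin_cases i <;> simp [minCoord]

theorem le_maxCoord (v : Fin 3 → ℝ) (i : Fin 3) : v i ≤ maxCoord v := by
  fin_cases i <;> simp [maxCoord]

theorem exists_eq_minCoord (v : Fin 3 → ℝ) : ∃ i, v i = minCoord v := by
  unfold minCoord
  rcases min_choice (v 0) (min (v 1) (v 2)) with h | h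
  · exact ⟨0, h.symm⟩
  rcases min_choice (v 1) (v 2) with h' | h' <;> rw [h, h']
  exacts [⟨1, rfl⟩, ⟨2, rfl⟩]

theorem exists_eq_maxCoord (v : Fin 3 → ℝ) : ∃ i, v i = maxCoord v := by
  unfold maxCoord
  rcases max_choice (v 0) (max (v 1) (v 2)) with h | h
  · exact ⟨0, h.symm⟩
  rcases max_choice (v 1) (v 2) with h' | h' <;> rw [h, h']
  exacts [⟨1, rfl⟩, ⟨2, rfl⟩]

variable {Z : Type*} [TopologicalSpace Z]

/-- Radial projection from the diagonal onto the hexagon, composed with `φ`; the diagonal itself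
is blown up to the whole hexagon. -/
def blowRel (φ : Z → Fin 3 → ℝ) : Set (Z × (Fin 3 → ℝ)) :=
  {p | p.2 ∈ hexagon ∧ ∀ i, φ p.1 i - minCoord (φ p.1) =
    (maxCoord (φ p.1) - minCoord (φ p.1)) * p.2 i}

theorem isClosed_blowRel {φ : Z → Fin 3 → ℝ} (hφ : Continuous φ) : IsClosed (blowRel φ) := by
  have h₁ : Continuous fun z => minCoord (φ z) := continuous_minCoord.comp hφ
  have h₂ : Continuous fun z => maxCoord (φ z) := continuous_maxCoord.comp hφ
  have h₃ : ∀ i, Continuous fun z => φ z i := fun i => (continuous_apply i).comp hφ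
  have h : IsClosed {p : Z × (Fin 3 → ℝ) | ∀ i, φ p.1 i - minCoord (φ p.1) =
      (maxCoord (φ p.1) - minCoord (φ p.1)) * p.2 i} := by
    rw [Set.ofPred_forall]
    exact isClosed_iInter fun i =>
      isClosed_eq (((h₃ i).comp continuous_fst).sub (h₁.comp continuous_fst))
        (((h₂.comp continuous_fst).sub (h₁.comp continuous_fst)).mul
          ((continuous_apply i).comp continuous_snd))
  exact (isClosed_hexagon.preimage continuous_snd).inter h

theorem hasLifts_blowRel [T2Space Z] {φ : Z → Fin 3 → ℝ} (hφ : Continuous φ) :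
    HasLifts (blowRel φ) := by
  refine hasLifts_of_fibers (W := Set.Icc 0 1) isCompact_Icc (isClosed_blowRel hφ)
    (fun p hp => ⟨fun i => (hp.1.1 i).1, fun i => (hp.1.1 i).2⟩) fun z => ?_
  obtain ⟨i, hi⟩ := exists_eq_minCoord (φ z)
  obtain ⟨j, hj⟩ := exists_eq_maxCoord (φ z)
  have hl := minCoord_le (φ z)
  have hu := le_maxCoord (φ z)
  rcases eq_or_lt_of_le ((hl i).trans (hu i)) with h | h
  · convert isConnected_hexagon using 1
    ext q
    refine ⟨fun hq => hq.1, fun hq => ⟨hq, fun k => ?_⟩⟩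
    have := hl k
    have := hu k
    simp only
    rw [← h, sub_self, zero_mul]
    linarith
  · have hpos : 0 < maxCoord (φ z) - minCoord (φ z) := sub_pos.2 h
    convert isConnected_singleton (x := fun k =>
      (φ z k - minCoord (φ z)) / (maxCoord (φ z) - minCoord (φ z))) using 1
    ext q
    constructor
    · intro hq
      rw [Set.mem_singleton_iff]
      funext k
      rw [eq_div_iff hpos.ne', mul_comm]
      exact (hq.2 k).symm
    · rintro rfl
      refine ⟨⟨fun k => ⟨?_, ?_⟩, ⟨i, ?_⟩, ⟨j, ?_⟩⟩, fun k => ?_⟩ <;> simp only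
      · exact div_nonneg (sub_nonneg.2 (hl k)) hpos.le
      · rw [div_le_one hpos]
        linarith [hu k]
      · rw [hi, sub_self, zero_div]
      · rw [hj, div_self hpos.ne']
      · rw [mul_div_cancel₀ _ hpos.ne']

end Blow

section Terms

/-- Truncation to the unit interval. -/
noncomputable def clamp (x : ℝ) : ℝ := max 0 (min 1 x)

theorem continuous_clamp : Continuous clamp := by
  unfold clamp
  fun_prop

theorem clamp_nonneg (x : ℝ) : 0 ≤ clamp x := le_max_left _ _

theorem clamp_le_one (x : ℝ) : clamp x ≤ 1 := max_le zero_le_one (min_le_left _ _)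

theorem clamp_of_nonpos {x : ℝ} (h : x ≤ 0) : clamp x = 0 :=
  max_eq_left ((min_le_right _ _).trans h)

theorem clamp_of_one_le {x : ℝ} (h : 1 ≤ x) : clamp x = 1 := by
  rw [clamp, min_eq_left h, max_eq_right zero_le_one]

/-- Symbols for the operations that generate new coordinates. -/
inductive CoordOp : Type
  | ramp (k : Fin 3) (r s : ℚ)
  | sup
  | inf
  | fold
  | blow

/-- The relation imposed on a new coordinate by an operation applied to three coordinates. -/
noncomputable def CoordOp.rel {Z : Type*} (a b c : Z → Fin 3 → ℝ) :
    CoordOp → Set (Z × (Fin 3 → ℝ))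
  | ramp k r s => {p | p.2 = fun _ => clamp ((a p.1 k - r) / (s - r))}
  | sup => {p | p.2 = fun _ => clamp (max (a p.1 0) (b p.1 0))}
  | inf => {p | p.2 = fun _ => clamp (min (a p.1 0) (b p.1 0))}
  | fold => foldRel (fun z => 3 / 2 * (clamp (a z 0) + clamp (b z 0)))
      (fun z _ => 3 / 2 * (clamp (a z 0) + clamp (b z 0)))
      (fun z _ => 4 - 3 / 2 * (clamp (a z 0) + clamp (b z 0)))
      (fun z _ => 3 / 2 * (clamp (a z 0) + clamp (b z 0)) + 2)
  | blow => blowRel fun z => ![a z 0, b z 0, c z 0]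

namespace CoordOp

section

variable {Z : Type*} [TopologicalSpace Z] {a b c : Z → Fin 3 → ℝ}

theorem isClosed_rel (ha : Continuous a) (hb : Continuous b) (hc : Continuous c) (o : CoordOp) :
    IsClosed (o.rel a b c) := by
  have hcl := continuous_clamp
  cases o with
  | ramp k r s => exact isClosed_eq (by fun_prop) (by fun_prop)
  | sup => exact isClosed_eq (by fun_prop) (by fun_prop)
  | inf => exact isClosed_eq (by fun_prop) (by fun_prop)
  | fold =>
    rw [rel]
    apply isClosed_foldRel <;> fun_prop
  | blow =>
    rw [rel]
    apply isClosed_blowRel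
    fun_prop

theorem hasLifts_rel [T2Space Z] (ha : Continuous a) (hb : Continuous b) (hc : Continuous c) (o : CoordOp) :
    HasLifts (o.rel a b c) := by
  have hcl := continuous_clamp
  cases o with
  | ramp k r s => exact hasLifts_graph (h := fun z _ => clamp ((a z k - r) / (s - r))) (by fun_prop)
  | sup => exact hasLifts_graph (h := fun z _ => clamp (max (a z 0) (b z 0))) (by fun_prop)
  | inf => exact hasLifts_graph (h := fun z _ => clamp (min (a z 0) (b z 0))) (by fun_prop)
  | fold =>
    rw [rel]
    apply hasLifts_foldRel
    any_goals fun_prop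
    all_goals
      intro z hz
      simp only [hz]
      norm_num
  | blow =>
    rw [rel]
    apply hasLifts_blowRel
    fun_prop

end

variable {Z : Type*} {a b c : Z → Fin 3 → ℝ}

theorem mem_Icc_of_mem_rel {o : CoordOp} {p : Z × (Fin 3 → ℝ)} (hp : p ∈ o.rel a b c) :
    p.2 ∈ Set.Icc (0 : Fin 3 → ℝ) 5 := by
  have hcl := clamp_nonneg
  have hcl' := clamp_le_one
  obtain ⟨z, q⟩ := p
  suffices h : ∀ i, 0 ≤ q i ∧ q i ≤ 5 from ⟨fun i => (h i).1, fun i => (h i).2⟩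
  intro i
  have h₁ := hcl (a z 0)
  have h₂ := hcl' (a z 0)
  have h₃ := hcl (b z 0)
  have h₄ := hcl' (b z 0)
  cases o with
  | ramp k r s => rw [show q = _ from hp]; exact ⟨hcl _, (hcl' _).trans (by norm_num)⟩
  | sup => rw [show q = _ from hp]; exact ⟨hcl _, (hcl' _).trans (by norm_num)⟩
  | inf => rw [show q = _ from hp]; exact ⟨hcl _, (hcl' _).trans (by norm_num)⟩
  | fold =>
    rcases hp with ⟨h, hq⟩ | ⟨h, hq⟩ | ⟨h, hq⟩ <;> simp only at h hq <;> subst hq <;>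
      constructor <;> linarith
  | blow => exact ⟨(hp.1.1 i).1, (hp.1.1 i).2.trans (by norm_num)⟩

/-- The relation depends only on the values of the arguments. -/
theorem mem_rel_congr {Z' : Type*} {a' b' c' : Z' → Fin 3 → ℝ} {o : CoordOp} {z : Z} {z' : Z'}
    {q : Fin 3 → ℝ} (ha : a z = a' z') (hb : b z = b' z') (hc : c z = c' z')
    (h : (z, q) ∈ o.rel a b c) : (z', q) ∈ o.rel a' b' c' := by
  cases o <;> simpa [rel, foldRel, blowRel, ha, hb, hc] using h

end CoordOp

/-- Formal expressions naming the coordinates of the space to be constructed. -/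
inductive CoordTerm (ι : Type u) : Type u
  | base (i : ι)
  | node (o : CoordOp) (a b c : CoordTerm ι)

namespace CoordTerm

variable {ι : Type u} {X : Type*}

/-- The constraint on the coordinate named by a term. -/
noncomputable def rel (e : ι → X → ℝ) :
    CoordTerm ι → Set ((X × (CoordTerm ι → Fin 3 → ℝ)) × (Fin 3 → ℝ))
  | base i => {p | p.2 = fun _ => clamp (e i p.1.1)}
  | node o a b c => o.rel (fun z => z.2 a) (fun z => z.2 b) fun z => z.2 c

theorem exists_continuum [TopologicalSpace X] [CompactSpace X] [T2Space X] [ConnectedSpace X]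
    {e : ι → X → ℝ} (he : ∀ i, Continuous (e i)) :
    ∃ M : Set (X × (CoordTerm ι → Fin 3 → ℝ)), IsContinuum M ∧ Prod.fst '' M = Set.univ ∧
      (∀ z ∈ M, ∀ t, (z, z.2 t) ∈ rel e t) ∧
      ∀ K : Set X, IsContinuum K → ∃ N ⊆ M, IsContinuum N ∧ Prod.fst '' N = K := by
  have hcl := continuous_clamp
  refine exists_continuum_forall (W := Set.Icc 0 5) (q₀ := 0) isCompact_Icc
    ⟨le_rfl, fun _ => by simp⟩ sizeOf (fun t => ?_) (fun t p hp => ?_) (fun t => ?_)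
    fun t x z z' q h hz => ?_
  · cases t with
    | base i => exact isClosed_eq (by fun_prop) (by fun_prop)
    | node o a b c =>
      rw [rel]
      apply CoordOp.isClosed_rel <;> fun_prop
  · cases t with
    | base i =>
      rw [show p.2 = _ from hp]
      exact ⟨fun _ => clamp_nonneg _, fun _ => (clamp_le_one _).trans (by norm_num)⟩
    | node o a b c =>
      rw [rel] at hp
      exact CoordOp.mem_Icc_of_mem_rel hp
  · cases t with
    | base i =>
      exact hasLifts_graph
        (h := fun (z : X × (CoordTerm ι → Fin 3 → ℝ)) _ => clamp (e i z.1)) (by fun_prop)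
    | node o a b c =>
      rw [rel]
      apply CoordOp.hasLifts_rel <;> fun_prop
  · cases t with
    | base i => exact hz
    | node o a b c =>
      rw [rel] at hz ⊢
      refine CoordOp.mem_rel_congr (z := (x, z)) (z' := (x, z')) (h a ?_) (h b ?_) (h c ?_) hz <;>
        simp only [node.sizeOf_spec] <;> omega

end CoordTerm

end Terms

section Coordinates

open Topology

/-- A point-separating family of continuous coordinates, named by terms, in which every node
satisfies the relation of its operation. -/
structure IsCoordSystem {ι : Type u} {Y : Type*} [TopologicalSpace Y]
    (v : CoordTerm ι → Y → Fin 3 → ℝ) : Prop where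
  continuous : ∀ t, Continuous (v t)
  separates : ∀ y y', y ≠ y' → ∃ t, v t y ≠ v t y'
  nonneg : ∀ t y i, 0 ≤ v t y i
  mem_rel : ∀ o a b c y, (y, v (.node o a b c) y) ∈ CoordOp.rel (v a) (v b) (v c) o

namespace IsCoordSystem

variable {ι : Type u} {Y : Type*} [TopologicalSpace Y] {v : CoordTerm ι → Y → Fin 3 → ℝ}

theorem ramp_apply (hv : IsCoordSystem v) (a : CoordTerm ι) (k : Fin 3) (r s : ℚ) (y : Y)
    (i : Fin 3) : v (.node (.ramp k r s) a a a) y i = clamp ((v a y k - r) / (s - r)) :=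
  congrFun (hv.mem_rel (.ramp k r s) a a a y : v _ y = _) i

theorem sup_apply (hv : IsCoordSystem v) (a b : CoordTerm ι) (y : Y) (i : Fin 3) :
    v (.node .sup a b b) y i = clamp (max (v a y 0) (v b y 0)) :=
  congrFun (hv.mem_rel .sup a b b y : v _ y = _) i

theorem inf_apply (hv : IsCoordSystem v) (a b : CoordTerm ι) (y : Y) (i : Fin 3) :
    v (.node .inf a b b) y i = clamp (min (v a y 0) (v b y 0)) :=
  congrFun (hv.mem_rel .inf a b b y : v _ y = _) i

theorem exists_eq_zero [Nonempty ι] (hv : IsCoordSystem v) : ∃ t, ∀ y, v t y 0 = 0 := by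
  obtain ⟨i⟩ := ‹Nonempty ι›
  refine ⟨.node (.ramp 0 0 0) (.base i) (.base i) (.base i), fun y => ?_⟩
  rw [hv.ramp_apply]
  exact clamp_of_nonpos (by simp)

theorem exists_eq_one [Nonempty ι] (hv : IsCoordSystem v) : ∃ t, ∀ y, v t y 0 = 1 := by
  obtain ⟨t, ht⟩ := hv.exists_eq_zero
  refine ⟨.node (.ramp 0 1 0) t t t, fun y => ?_⟩
  rw [hv.ramp_apply, ht]
  exact clamp_of_one_le (by norm_num)

theorem exists_eventually_eq_one (hv : IsCoordSystem v) {p q : Y} (hpq : p ≠ q) :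
    ∃ t, v t p 0 = 0 ∧ ∀ᶠ y in 𝓝 q, v t y 0 = 1 := by
  obtain ⟨a, ha⟩ := hv.separates p q hpq
  obtain ⟨k, hk⟩ := Function.ne_iff.1 ha
  have hc : Continuous fun y => v a y k := (continuous_apply k).comp (hv.continuous a)
  rcases hk.lt_or_gt with h | h
  · obtain ⟨r, hr, hr'⟩ := exists_rat_btwn h
    obtain ⟨s, hs, hs'⟩ := exists_rat_btwn hr'
    refine ⟨.node (.ramp k r s) a a a, ?_, ?_⟩
    · rw [hv.ramp_apply]
      exact clamp_of_nonpos (div_nonpos_of_nonpos_of_nonneg (by linarith) (by linarith))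
    · filter_upwards [hc.continuousAt.eventually (lt_mem_nhds hs')] with y hy
      rw [hv.ramp_apply]
      apply clamp_of_one_le
      rw [le_div_iff₀ (by linarith)]
      linarith
  · obtain ⟨r, hr, hr'⟩ := exists_rat_btwn h
    obtain ⟨s, hs, hs'⟩ := exists_rat_btwn hr
    refine ⟨.node (.ramp k r s) a a a, ?_, ?_⟩
    · rw [hv.ramp_apply]
      exact clamp_of_nonpos (div_nonpos_of_nonneg_of_nonpos (by linarith) (by linarith))
    · filter_upwards [hc.continuousAt.eventually (gt_mem_nhds hs)] with y hy
      rw [hv.ramp_apply]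
      apply clamp_of_one_le
      rw [le_div_iff_of_neg (by linarith)]
      linarith

theorem exists_zero_at_one_on [Nonempty ι] (hv : IsCoordSystem v) {p : Y} {D : Set Y}
    (hD : IsCompact D) (hp : p ∉ D) : ∃ t, v t p 0 = 0 ∧ ∀ y ∈ D, v t y 0 = 1 := by
  refine hD.induction_on (p := fun S => ∃ t, v t p 0 = 0 ∧ ∀ y ∈ S, v t y 0 = 1) ?_ ?_ ?_ ?_
  · obtain ⟨t, ht⟩ := hv.exists_eq_zero
    exact ⟨t, ht p, by simp⟩
  · rintro S T hST ⟨t, h, h'⟩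
    exact ⟨t, h, fun y hy => h' y (hST hy)⟩
  · rintro S T ⟨t, h₀, h₁⟩ ⟨t', h₀', h₁'⟩
    refine ⟨.node .sup t t' t', ?_, ?_⟩
    · rw [hv.sup_apply, h₀, h₀']
      exact clamp_of_nonpos (by simp)
    · rintro y (hy | hy) <;> rw [hv.sup_apply] <;> apply clamp_of_one_le
      · exact (h₁ y hy).ge.trans (le_max_left _ _)
      · exact (h₁' y hy).ge.trans (le_max_right _ _)
  · intro q hq
    obtain ⟨t, h₀, h₁⟩ := hv.exists_eventually_eq_one (ne_of_mem_of_not_mem hq hp).symm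
    exact ⟨_, mem_nhdsWithin_of_mem_nhds h₁, t, h₀, fun y hy => hy⟩

/-- The first coordinates of the terms satisfy Urysohn's lemma. -/
theorem exists_zero_on_one_on [Nonempty ι] (hv : IsCoordSystem v) {C D : Set Y}
    (hC : IsCompact C) (hD : IsCompact D) (hCD : Disjoint C D) :
    ∃ t, (∀ y ∈ C, v t y 0 = 0) ∧ ∀ y ∈ D, v t y 0 = 1 := by
  refine hC.induction_on (p := fun S => ∃ t, (∀ y ∈ S, v t y 0 = 0) ∧ ∀ y ∈ D, v t y 0 = 1)
    ?_ ?_ ?_ ?_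
  · obtain ⟨t, ht⟩ := hv.exists_eq_one
    exact ⟨t, by simp, fun y _ => ht y⟩
  · rintro S T hST ⟨t, h, h'⟩
    exact ⟨t, fun y hy => h y (hST hy), h'⟩
  · rintro S T ⟨t, h₀, h₁⟩ ⟨t', h₀', h₁'⟩
    refine ⟨.node .inf t t' t', ?_, fun y hy => ?_⟩
    · rintro y (hy | hy) <;> rw [hv.inf_apply] <;> apply clamp_of_nonpos
      · exact (min_le_left _ _).trans (h₀ y hy).le
      · exact (min_le_right _ _).trans (h₀' y hy).le
    · rw [hv.inf_apply, h₁ y hy, h₁' y hy]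
      exact clamp_of_one_le (by simp)
  · intro p hp
    obtain ⟨t, h₀, h₁⟩ := hv.exists_zero_at_one_on hD (Set.disjoint_left.1 hCD hp)
    have hc : Continuous fun y => v t y 0 := (continuous_apply 0).comp (hv.continuous t)
    have hlt : v t p 0 < 1 / 2 := by
      rw [h₀]
      norm_num
    refine ⟨_, mem_nhdsWithin_of_mem_nhds (hc.continuousAt.eventually (gt_mem_nhds hlt)),
      .node (.ramp 0 (1 / 2) 1) t t t, fun y hy => ?_, fun y hy => ?_⟩
    · rw [hv.ramp_apply]
      have hy' : v t y 0 < 1 / 2 := hy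
      apply clamp_of_nonpos
      push_cast
      exact div_nonpos_of_nonpos_of_nonneg (by linarith) (by norm_num)
    · rw [hv.ramp_apply, h₁ y hy]
      exact clamp_of_one_le (by norm_num)

theorem hereditarilyIndecomposable [T2Space Y] [Nonempty ι] (hv : IsCoordSystem v) :
    HereditarilyIndecomposable Y := by
  rintro K L hK hK' hL hL' ⟨z, hzK, hzL⟩
  by_contra! hKL
  obtain ⟨x, hxK, hxL⟩ := Set.not_subset.1 hKL.1
  obtain ⟨y, hyL, hyK⟩ := Set.not_subset.1 hKL.2
  obtain ⟨a, ha₀, ha₁⟩ := hv.exists_zero_at_one_on hL hxL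
  obtain ⟨b, hb₀, hb₁⟩ := hv.exists_zero_on_one_on hK (isCompact_singleton (x := y))
    (Set.disjoint_singleton_right.2 hyK)
  have hcl := clamp_nonneg
  have hcl' := clamp_le_one
  have c₀ : clamp 0 = 0 := clamp_of_nonpos le_rfl
  have c₁ : clamp 1 = 1 := clamp_of_one_le le_rfl
  set t : CoordTerm ι := .node .fold a b b
  have hrel : ∀ y, (y, v t y) ∈ CoordOp.rel (v a) (v b) (v b) .fold := hv.mem_rel .fold a b b
  simp only [CoordOp.rel, foldRel, Set.mem_ofPred_eq] at hrel
  have hrel' : ∀ y, _ := fun y => (hrel y).imp (And.imp_right fun h => congrFun h 0)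
    (Or.imp (And.imp_right fun h => congrFun h 0) (And.imp_right fun h => congrFun h 0))
  have hc : Continuous fun y => v t y 0 := (continuous_apply 0).comp (hv.continuous t)
  have hzK' : v t z 0 < 2 := by
    by_contra! h
    obtain ⟨w, hwK, hw⟩ : (2 : ℝ) ∈ (fun y => v t y 0) '' K := by
      refine hK'.isPreconnected.intermediate_value hxK hzK hc.continuousOn ⟨?_, h⟩
      have h₁ := hrel' x
      rw [ha₀, hb₀ x hxK, c₀] at h₁
      rcases h₁ with ⟨-, h₁⟩ | ⟨⟨h₁, -⟩, -⟩ | ⟨h₁, -⟩ <;> linarith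
    have h₁ := hrel' w
    simp only at hw
    rw [hb₀ w hwK, c₀, hw] at h₁
    have := hcl' (v a w 0)
    rcases h₁ with ⟨-, h₁⟩ | ⟨-, h₁⟩ | ⟨h₀, h₁⟩ <;> linarith
  have hzL' : 3 < v t z 0 := by
    by_contra! h
    obtain ⟨w, hwL, hw⟩ : (3 : ℝ) ∈ (fun y => v t y 0) '' L := by
      refine hL'.isPreconnected.intermediate_value hzL hyL hc.continuousOn ⟨h, ?_⟩
      have h₁ := hrel' y
      rw [ha₁ y hyL, hb₁ y rfl, c₁] at h₁
      rcases h₁ with ⟨h₁, -⟩ | ⟨⟨-, h₁⟩, -⟩ | ⟨-, h₁⟩ <;> linarith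
    have h₁ := hrel' w
    simp only at hw
    rw [ha₁ w hwL, c₁, hw] at h₁
    have := hcl (v b w 0)
    rcases h₁ with ⟨h₀, h₁⟩ | ⟨-, h₁⟩ | ⟨-, h₁⟩ <;> linarith
  linarith

theorem dimLeOne [CompactSpace Y] [Nonempty ι] (hv : IsCoordSystem v) : DimLeOne Y := by
  intro A B C hA hB hC hABC
  have hc : ∀ t i, Continuous fun y => v t y i := fun t i =>
    (continuous_apply i).comp (hv.continuous t)
  have hz : ∀ t, IsClosed {y | v t y 0 = 0} := fun t => isClosed_eq (hc t 0) continuous_const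
  obtain ⟨a, ha₀, ha₁⟩ := hv.exists_zero_on_one_on hA.isCompact (hB.inter hC).isCompact
    (Set.disjoint_iff_inter_eq_empty.2 (by rwa [← Set.inter_assoc]))
  obtain ⟨b, hb₀, hb₁⟩ := hv.exists_zero_on_one_on hB.isCompact ((hz a).inter hC).isCompact
    (Set.disjoint_left.2 fun y hy hy' => by
      have := ha₁ y ⟨hy, hy'.2⟩
      rw [show v a y 0 = 0 from hy'.1] at this
      norm_num at this)
  obtain ⟨c, hc₀, hc₁⟩ := hv.exists_zero_on_one_on hC.isCompact ((hz a).inter (hz b)).isCompact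
    (Set.disjoint_left.2 fun y hy hy' => by
      have := hb₁ y ⟨hy'.1, hy⟩
      rw [show v b y 0 = 0 from hy'.2] at this
      norm_num at this)
  set t : CoordTerm ι := .node .blow a b c
  have hrel : ∀ y, (y, v t y) ∈ CoordOp.rel (v a) (v b) (v c) .blow := hv.mem_rel .blow a b c
  simp only [CoordOp.rel, blowRel, Set.mem_ofPred_eq] at hrel
  have hzero : ∀ y i, ![v a y 0, v b y 0, v c y 0] i = 0 → v t y i = 0 := by
    intro y i hi
    set φ : Fin 3 → ℝ := ![v a y 0, v b y 0, v c y 0]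
    have hφ : ∀ j, 0 ≤ φ j := by
      intro j
      fin_cases j <;> exact hv.nonneg _ _ _
    obtain ⟨j, hj⟩ := exists_eq_minCoord φ
    have hmin : minCoord φ = 0 :=
      le_antisymm ((minCoord_le φ i).trans hi.le) (hj ▸ hφ j)
    have hmax : 0 < maxCoord φ := by
      by_contra! hmax
      have h : ∀ j, φ j = 0 := fun j => le_antisymm ((le_maxCoord φ j).trans hmax) (hφ j)
      have := hc₁ y ⟨h 0, h 1⟩
      rw [show v c y 0 = 0 from h 2] at this
      norm_num at this
    have : φ i - minCoord φ = (maxCoord φ - minCoord φ) * v t y i := (hrel y).2 i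
    rw [hi, hmin, sub_zero, sub_zero, eq_comm, mul_eq_zero] at this
    exact this.resolve_left hmax.ne'
  refine ⟨{y | v t y 0 = 0}, {y | v t y 1 = 0}, {y | v t y 2 = 0},
    isClosed_eq (hc t 0) continuous_const, isClosed_eq (hc t 1) continuous_const,
    isClosed_eq (hc t 2) continuous_const, fun y hy => hzero y 0 (ha₀ y hy),
    fun y hy => hzero y 1 (hb₀ y hy), fun y hy => hzero y 2 (hc₀ y hy), ?_, ?_⟩
  · refine Set.eq_empty_of_forall_notMem fun y hy => ?_
    obtain ⟨i, hi⟩ := (hrel y).1.2.2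
    have h : ∀ i, v t y i = 0 := Fin.forall_fin_succ.2
      ⟨hy.1.1, Fin.forall_fin_succ.2 ⟨hy.1.2, Fin.forall_fin_one.2 hy.2⟩⟩
    rw [h i] at hi
    norm_num at hi
  · refine Set.eq_univ_of_forall fun y => ?_
    obtain ⟨i, hi⟩ := (hrel y).1.2.1
    fin_cases i
    exacts [Or.inl (Or.inl hi), Or.inl (Or.inr hi), Or.inr hi]

theorem isTopologicalBasis [CompactSpace Y] [T2Space Y] [Nonempty ι] (hv : IsCoordSystem v) :
    TopologicalSpace.IsTopologicalBasis (Set.range fun t => {y | v t y 0 < 1 / 2}) := by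
  have hc : ∀ t, Continuous fun y => v t y 0 := fun t =>
    (continuous_apply 0).comp (hv.continuous t)
  refine TopologicalSpace.isTopologicalBasis_of_isOpen_of_nhds ?_ fun p U hp hU => ?_
  · rintro _ ⟨t, rfl⟩
    exact isOpen_lt (hc t) continuous_const
  · obtain ⟨t, h₀, h₁⟩ := hv.exists_zero_at_one_on hU.isClosed_compl.isCompact
      (fun h : p ∈ Uᶜ => h hp)
    refine ⟨_, ⟨t, rfl⟩, ?_, fun y hy => ?_⟩
    · change v t p 0 < 1 / 2
      rw [h₀]
      norm_num
    · by_contra hyU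
      have hy' : v t y 0 < 1 / 2 := hy
      rw [h₁ y hyU] at hy'
      norm_num at hy'

end IsCoordSystem

end Coordinates

section Weight

open TopologicalSpace Cardinal

theorem weight_le {X : Type u} [TopologicalSpace X] {B : Set (Set X)}
    (hB : IsTopologicalBasis B) : weight X ≤ #B :=
  ciInf_le' (fun B : {B : Set (Set X) // IsTopologicalBasis B} => #B.1) ⟨B, hB⟩

theorem exists_isTopologicalBasis_mk_eq_weight (X : Type u) [TopologicalSpace X] :
    ∃ B : Set (Set X), IsTopologicalBasis B ∧ #B = weight X := by
  have : Nonempty {B : Set (Set X) // IsTopologicalBasis B} := ⟨⟨_, isTopologicalBasis_opens⟩⟩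
  obtain ⟨B, hB⟩ := ciInf_mem fun B : {B : Set (Set X) // IsTopologicalBasis B} => #B.1
  exact ⟨B.1, B.2, hB⟩

theorem TopologicalSpace.IsTopologicalBasis.infinite {X : Type u} [TopologicalSpace X] [T0Space X]
    [Infinite X] {B : Set (Set X)} (hB : IsTopologicalBasis B) : Infinite B := by
  by_contra hfin
  have : Finite B := not_infinite_iff_finite.1 hfin
  have hinj : Function.Injective fun (x : X) => {b : B | x ∈ b.1} := by
    intro x y hxy
    refine (hB.inseparable_iff.2 fun s hs => ?_).eq
    exact Set.ext_iff.1 hxy ⟨s, hs⟩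
  exact not_finite_iff_infinite.2 ‹Infinite X› (Finite.of_injective _ hinj)

theorem weight_le_of_surjective {X Y : Type u} [TopologicalSpace X] [TopologicalSpace Y]
    [CompactSpace Y] [T2Space Y] [T2Space X] [Infinite X] {f : Y → X} (hf : Continuous f)
    (hsurj : Function.Surjective f) : weight X ≤ weight Y := by
  obtain ⟨B, hB, hcard⟩ := exists_isTopologicalBasis_mk_eq_weight Y
  have : Infinite Y := Infinite.of_surjective f hsurj
  have : Infinite B := hB.infinite
  let b : Finset B → Set X := fun F => (f '' (⋃ s ∈ F, s.1)ᶜ)ᶜ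
  have hopen : ∀ F : Finset B, IsOpen (⋃ s ∈ F, s.1) := fun F =>
    isOpen_biUnion fun s _ => hB.isOpen s.2
  have hb : IsTopologicalBasis (Set.range b) := by
    refine isTopologicalBasis_of_isOpen_of_nhds ?_ fun x U hx hU => ?_
    · rintro _ ⟨F, rfl⟩
      exact ((hopen F).isClosed_compl.isCompact.image hf).isClosed.isOpen_compl
    · have hcompact : IsCompact (f ⁻¹' {x}) := (isClosed_singleton.preimage hf).isCompact
      have hcover : ∃ F : Finset B, f ⁻¹' {x} ⊆ ⋃ s ∈ F, s.1 ∧ ⋃ s ∈ F, s.1 ⊆ f ⁻¹' U := by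
        refine hcompact.induction_on
          (p := fun S => ∃ F : Finset B, S ⊆ ⋃ s ∈ F, s.1 ∧ ⋃ s ∈ F, s.1 ⊆ f ⁻¹' U) ?_ ?_ ?_ ?_
        · exact ⟨∅, by simp⟩
        · rintro S T hST ⟨F, h, h'⟩
          exact ⟨F, hST.trans h, h'⟩
        · classical
          rintro S T ⟨F, h, h'⟩ ⟨G, k, k'⟩
          refine ⟨F ∪ G, ?_, ?_⟩ <;> rw [Finset.set_biUnion_union]
          exacts [Set.union_subset_union h k, Set.union_subset h' k']
        · intro y hy
          have hyU : f y ∈ U := (Set.eq_of_mem_singleton hy).symm ▸ hx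
          obtain ⟨s, hs, hys, hsU⟩ := hB.exists_subset_of_mem_open
            (show y ∈ f ⁻¹' U from hyU) (hU.preimage hf)
          exact ⟨s, mem_nhdsWithin_of_mem_nhds (hB.mem_nhds hs hys), {⟨s, hs⟩}, by simpa⟩
      obtain ⟨F, h, h'⟩ := hcover
      refine ⟨b F, ⟨F, rfl⟩, ?_, fun x' hx' => ?_⟩
      · rintro ⟨y, hy, hyx⟩
        exact hy (h hyx)
      · obtain ⟨y, rfl⟩ := hsurj x'
        by_contra hyU
        exact hx' ⟨y, fun hy => hyU (h' hy), rfl⟩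
  calc weight X ≤ #(Set.range b) := weight_le hb
    _ ≤ #(Finset B) := mk_range_le
    _ = weight Y := by rw [mk_finset_of_infinite, hcard]

instance : Countable CoordOp := by
  let code : CoordOp → ℕ × Fin 3 × ℚ × ℚ
    | .ramp k r s => (0, k, r, s)
    | .sup => (1, 0, 0, 0)
    | .inf => (2, 0, 0, 0)
    | .fold => (3, 0, 0, 0)
    | .blow => (4, 0, 0, 0)
  refine Function.Injective.countable (f := code) ?_
  intro a b h
  cases a <;> cases b <;> simp_all [code]

/-- The number of arguments of a label, as a type. -/
def CoordTerm.arity {ι : Type u} : ι ⊕ CoordOp → Type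
  | .inl _ => Empty
  | .inr _ => Fin 3

/-- A term as a well-founded tree. -/
def CoordTerm.toWType {ι : Type u} : CoordTerm ι → WType (arity (ι := ι))
  | base i => .mk (.inl i) Empty.elim
  | node o a b c => .mk (.inr o) ![a.toWType, b.toWType, c.toWType]

theorem CoordTerm.toWType_injective {ι : Type u} :
    Function.Injective (toWType : CoordTerm ι → _) := by
  intro s
  induction s with
  | base i =>
    intro t h
    cases t with
    | base j => rw [Sum.inl.inj (WType.mk.inj h).1]
    | node o a b c => exact absurd (WType.mk.inj h).1 Sum.inl_ne_inr
  | node o a b c iha ihb ihc =>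
    intro t h
    cases t with
    | base j => exact absurd (WType.mk.inj h).1 Sum.inr_ne_inl
    | node o' a' b' c' =>
      obtain ⟨ho, h⟩ := WType.mk.inj h
      obtain rfl := Sum.inr.inj ho
      have h : ![a.toWType, b.toWType, c.toWType] = ![a'.toWType, b'.toWType, c'.toWType] :=
        eq_of_heq h
      rw [iha (congrFun h 0), ihb (congrFun h 1), ihc (congrFun h 2)]

theorem CoordTerm.mk_le (ι : Type u) [Infinite ι] : #(CoordTerm ι) ≤ #ι := by
  have hfin : ∀ l : ι ⊕ CoordOp, Finite (CoordTerm.arity l)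
    | .inl _ => inferInstanceAs (Finite Empty)
    | .inr _ => inferInstanceAs (Finite (Fin 3))
  have h₀ : ℵ₀ ≤ #ι := aleph0_le_mk ι
  have h₁ : #(WType (CoordTerm.arity (ι := ι))) ≤ max #(ι ⊕ CoordOp) ℵ₀ := by
    simpa using WType.cardinalMk_le_max_aleph0_of_finite' (β := CoordTerm.arity (ι := ι))
  refine ((mk_le_of_injective toWType_injective).trans h₁).trans (max_le ?_ h₀)
  rw [mk_sum]
  refine add_le_of_le h₀ (by simp) (le_trans ?_ h₀)
  simp

end Weight

section Assembly

open TopologicalSpace Cardinal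

theorem weight_coord_le {ι Y : Type u} [TopologicalSpace Y] [CompactSpace Y] [T2Space Y]
    [Infinite ι] {v : CoordTerm ι → Y → Fin 3 → ℝ} (hv : IsCoordSystem v) : weight Y ≤ #ι :=
  ((weight_le hv.isTopologicalBasis).trans mk_range_le).trans (CoordTerm.mk_le ι)

/-- A compact Hausdorff space has a point-separating family of functions into the unit interval
indexed by the pairs of members of a given base. -/
theorem TopologicalSpace.IsTopologicalBasis.exists_separating {X : Type u} [TopologicalSpace X]
    [CompactSpace X] [T2Space X] {B : Set (Set X)} (hB : IsTopologicalBasis B) :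
    ∃ e : B × B → X → ℝ, (∀ i, Continuous (e i)) ∧ (∀ i x, e i x ∈ Set.Icc 0 1) ∧
      ∀ x y, x ≠ y → ∃ i, e i x ≠ e i y := by
  have h : ∀ i : B × B, ∃ g : C(X, ℝ), (∀ x, g x ∈ Set.Icc (0 : ℝ) 1) ∧
      (closure i.1.1 ⊆ i.2.1 → (∀ x ∈ i.1.1, g x = 0) ∧ ∀ x ∉ i.2.1, g x = 1) := by
    rintro ⟨⟨s, hs⟩, t, ht⟩
    by_cases hst : closure s ⊆ t
    · obtain ⟨g, h₀, h₁, hg⟩ := exists_continuous_zero_one_of_isClosed (isClosed_closure (s := s))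
        (hB.isOpen ht).isClosed_compl (Set.disjoint_compl_right_iff_subset.2 hst)
      exact ⟨g, hg, fun _ => ⟨fun x hx => h₀ (subset_closure hx), fun x hx => h₁ hx⟩⟩
    · exact ⟨0, by simp, fun h => absurd h hst⟩
  choose g hg hg' using h
  refine ⟨fun i => g i, fun i => (g i).continuous, hg, fun x y hxy => ?_⟩
  obtain ⟨t, ht, hxt, hty⟩ := hB.exists_subset_of_mem_open (show x ∈ ({y} : Set X)ᶜ from hxy)
    isOpen_compl_singleton
  obtain ⟨s, hs, hxs, hst⟩ := hB.exists_closure_subset ((hB.isOpen ht).mem_nhds hxt)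
  obtain ⟨h₀, h₁⟩ := hg' (⟨s, hs⟩, ⟨t, ht⟩) hst
  refine ⟨(⟨s, hs⟩, ⟨t, ht⟩), ?_⟩
  simp only [h₀ x hxs, h₁ y fun hy => hty hy rfl]
  exact zero_ne_one

theorem clamp_of_mem_Icc {x : ℝ} (hx : x ∈ Set.Icc (0 : ℝ) 1) : clamp x = x := by
  rw [clamp, min_eq_right hx.2, max_eq_right hx.1]

theorem isCoordSystem_of_mem_rel {ι : Type u} {X : Type*} [TopologicalSpace X] {e : ι → X → ℝ}
    (he : ∀ i x, e i x ∈ Set.Icc (0 : ℝ) 1) (hsep : ∀ x y, x ≠ y → ∃ i, e i x ≠ e i y)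
    {M : Set (X × (CoordTerm ι → Fin 3 → ℝ))}
    (hM : ∀ z ∈ M, ∀ t, (z, z.2 t) ∈ CoordTerm.rel e t) :
    IsCoordSystem fun (t : CoordTerm ι) (y : M) => y.1.2 t where
  continuous t := by fun_prop
  separates := by
    rintro ⟨⟨x, q⟩, hy⟩ ⟨⟨x', q'⟩, hy'⟩ hne
    by_contra! h
    have hq : q = q' := funext h
    subst hq
    refine hne ?_
    congr 2
    by_contra hx
    obtain ⟨i, hi⟩ := hsep x x' hx
    have h₁ : q (.base i) = fun _ => clamp (e i x) := hM _ hy (.base i)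
    have h₂ : q (.base i) = fun _ => clamp (e i x') := hM _ hy' (.base i)
    have h₃ := congrFun (h₁.symm.trans h₂) 0
    rw [clamp_of_mem_Icc (he i x), clamp_of_mem_Icc (he i x')] at h₃
    exact hi h₃
  nonneg t y i := by
    have h := hM y.1 y.2 t
    cases t with
    | base j =>
      have h : y.1.2 (.base j) = fun _ => clamp (e j y.1.1) := h
      simp only [h]
      exact clamp_nonneg _
    | node o a b c =>
      rw [CoordTerm.rel] at h
      exact (CoordOp.mem_Icc_of_mem_rel h).1 i
  mem_rel o a b c y := by
    have h := hM y.1 y.2 (.node o a b c)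
    rw [CoordTerm.rel] at h
    exact CoordOp.mem_rel_congr (z := y.1) (z' := y) rfl rfl rfl h

end Assembly

/-- Every continuum is the weakly confluent image of a hereditarily indecomposable
continuum of the same weight and of dimension at most one. -/
theorem mackowiak_tymchatyn_general (X : Type u) [TopologicalSpace X] [CompactSpace X]
    [T2Space X] [ConnectedSpace X] :
    ∃ (Y : Type u) (_ : TopologicalSpace Y) (f : Y → X),
      CompactSpace Y ∧ ConnectedSpace Y ∧ T2Space Y ∧
      weight Y = weight X ∧
      HereditarilyIndecomposable Y ∧ DimLeOne Y ∧
      Continuous f ∧ Function.Surjective f ∧ WeaklyConfluent f := by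
  rcases subsingleton_or_nontrivial X with hX | hX
  · refine ⟨X, inferInstance, id, inferInstance, inferInstance, inferInstance, rfl, ?_, ?_,
      continuous_id, Function.surjective_id, fun K hK hK' => ⟨K, hK, hK', Set.image_id K⟩⟩
    · exact fun K L _ _ _ _ ⟨x, _, hxL⟩ => Or.inl fun y _ => Subsingleton.elim x y ▸ hxL
    · intro A B C hA hB hC hABC
      rcases Set.eq_empty_or_nonempty A with h | ⟨x, hx⟩
      · exact ⟨∅, Set.univ, Set.univ, isClosed_empty, isClosed_univ, isClosed_univ, h.subset,
          by simp, by simp, by simp, by simp⟩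
      · have hA : A = Set.univ := Set.eq_univ_of_forall fun y => Subsingleton.elim x y ▸ hx
        refine ⟨A, B, C, ‹_›, hB, hC, le_rfl, le_rfl, le_rfl, hABC, by simp [hA]⟩
  have hinf : Infinite X := PreconnectedSpace.infinite
  obtain ⟨B, hB, hcard⟩ := exists_isTopologicalBasis_mk_eq_weight X
  have hBinf : Infinite B := hB.infinite
  obtain ⟨e, he, heIcc, hsep⟩ := hB.exists_separating
  obtain ⟨M, hM, hfst, hrel, hlift⟩ := CoordTerm.exists_continuum he
  have hv := isCoordSystem_of_mem_rel heIcc hsep hrel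
  have hcompact : CompactSpace M := isCompact_iff_compactSpace.1 hM.isCompact
  have hconn : ConnectedSpace M := isConnected_iff_connectedSpace.1 hM.isConnected
  have hf : Continuous fun y : M => y.1.1 := by fun_prop
  have hsurj : Function.Surjective fun y : M => y.1.1 := by
    intro x
    obtain ⟨z, hz, rfl⟩ : x ∈ Prod.fst '' M := hfst ▸ Set.mem_univ x
    exact ⟨⟨z, hz⟩, rfl⟩
  refine ⟨M, inferInstance, fun y => y.1.1, hcompact, hconn, inferInstance,
    le_antisymm ?_ (weight_le_of_surjective hf hsurj), hv.hereditarilyIndecomposable,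
    hv.dimLeOne, hf, hsurj, fun K hK hK' => ?_⟩
  · refine (weight_coord_le hv).trans_eq ?_
    rw [Cardinal.mk_prod, Cardinal.lift_id, Cardinal.mul_eq_self (Cardinal.aleph0_le_mk B), hcard]
  · obtain ⟨N, hNM, hN, rfl⟩ := hlift K ⟨hK, hK'⟩
    refine ⟨Subtype.val ⁻¹' N, ?_, ?_, ?_⟩
    · rw [Subtype.isCompact_iff, Subtype.image_preimage_coe, Set.inter_eq_right.2 hNM]
      exact hN.isCompact
    · have himg : Subtype.val '' (Subtype.val ⁻¹' N : Set M) = N := by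
        rw [Subtype.image_preimage_coe, Set.inter_eq_right.2 hNM]
      refine ⟨(himg ▸ hN.isConnected.nonempty).of_image, ?_⟩
      rw [← Topology.IsInducing.subtypeVal.isPreconnected_image, himg]
      exact hN.isConnected.isPreconnected
    · change (Prod.fst ∘ Subtype.val) '' _ = _
      rw [Set.image_comp, Subtype.image_preimage_coe, Set.inter_eq_right.2 hNM]
end

section
/- For every continuum Z (compact connected Hausdorff, not necessarily metrizable) and all nonempty closed sets a, b, c ⊆ Z with a ∩ b ∩ c = ∅, there exist a continuum Z′, a continuous surjection g : Z′ → Z that is closed and monotone (i.e., g is a closed map and g⁻¹({z}) is connected for every z ∈ Z), and closed sets x, y, z ⊆ Z′ such that g⁻¹(a) ⊆ x, g⁻¹(b) ⊆ y, g⁻¹(c) ⊆ z, x ∩ y ∩ z = ∅ and x ∪ y ∪ z = Z′. -/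
universe u

/-- The unit vectors pointing in the direction of `w`; this is the whole unit circle
when `w = 0`. -/
def directions (w : ℂ) : Set ℂ := {s | ‖s‖ = 1 ∧ w = ‖w‖ * s}

theorem isConnected_directions (w : ℂ) : IsConnected (directions w) := by
  by_cases hw : w = 0
  · have : directions w = Metric.sphere (0 : ℂ) 1 := by
      ext s
      simp [directions, hw]
    rw [this]
    refine isConnected_sphere ?_ 0 zero_le_one
    rw [Complex.rank_real_complex]
    exact Cardinal.one_lt_two
  · have hn : (‖w‖ : ℂ) ≠ 0 := by simpa using hw
    have : directions w = {w / ‖w‖} := by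
      ext s
      simp only [directions, Set.mem_ofPred_eq, Set.mem_singleton_iff]
      constructor
      · rintro ⟨-, h⟩
        rw [eq_div_iff hn, mul_comm]
        exact h.symm
      · rintro rfl
        exact ⟨by simp [hw], by field_simp⟩
    rw [this]
    exact isConnected_singleton

/-- Three closed sets with empty intersection in a normal space are contained in the
zero sets of three continuous functions without a common zero. -/
theorem exists_continuous_zero_of_inter_eq_empty {Z : Type*} [TopologicalSpace Z]
    [NormalSpace Z] {a b c : Set Z} (ha : IsClosed a) (hb : IsClosed b) (hc : IsClosed c)
    (habc : a ∩ b ∩ c = ∅) :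
    ∃ f₁ f₂ f₃ : C(Z, ℝ), (∀ t, 0 ≤ f₁ t) ∧ (∀ t, 0 ≤ f₂ t) ∧ (∀ t, 0 ≤ f₃ t) ∧
      (∀ t ∈ a, f₁ t = 0) ∧ (∀ t ∈ b, f₂ t = 0) ∧ (∀ t ∈ c, f₃ t = 0) ∧
      ∀ t, f₁ t = 0 → f₂ t = 0 → f₃ t ≠ 0 := by
  obtain ⟨f₁, h₁, h₁', h₁''⟩ := exists_continuous_zero_one_of_isClosed ha (hb.inter hc) (by
    rw [Set.disjoint_iff_inter_eq_empty, ← Set.inter_assoc, habc])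
  have hz₁ : IsClosed {t | f₁ t = 0} := isClosed_eq f₁.continuous continuous_const
  obtain ⟨f₂, h₂, h₂', h₂''⟩ := exists_continuous_zero_one_of_isClosed hb (hc.inter hz₁) (by
    rw [Set.disjoint_left]
    rintro t htb ⟨htc, ht : f₁ t = 0⟩
    have : f₁ t = 1 := h₁' ⟨htb, htc⟩
    linarith)
  have hz₂ : IsClosed {t | f₂ t = 0} := isClosed_eq f₂.continuous continuous_const
  obtain ⟨f₃, h₃, h₃', h₃''⟩ := exists_continuous_zero_one_of_isClosed hc (hz₁.inter hz₂) (by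
    rw [Set.disjoint_left]
    rintro t htc ⟨ht₁, ht₂ : f₂ t = 0⟩
    have : f₂ t = 1 := h₂' ⟨htc, ht₁⟩
    linarith)
  refine ⟨f₁, f₂, f₃, fun t => (h₁'' t).1, fun t => (h₂'' t).1, fun t => (h₃'' t).1,
    fun t ht => h₁ ht, fun t ht => h₂ ht, fun t ht => h₃ ht, fun t ht₁ ht₂ ht₃ => ?_⟩
  have : f₃ t = 1 := h₃' ⟨ht₁, ht₂⟩
  linarith

/-- The preimage of a connected space under a closed continuous surjection with connected
fibers is connected. -/
theorem connectedSpace_of_isClosedMap_of_connected_fibers {X Y : Type*} [TopologicalSpace X]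
    [TopologicalSpace Y] [ConnectedSpace Y] {g : X → Y} (hg : Continuous g)
    (hcl : IsClosedMap g) (hfib : ∀ y, IsConnected (g ⁻¹' {y})) : ConnectedSpace X := by
  have hsurj : Function.Surjective g := fun y => (hfib y).nonempty
  have h := (hcl.isQuotientMap hg hsurj).isCoinducing.isConnected_preimage_of_isClosed hfib
    isClosed_univ isConnected_univ
  exact connectedSpace_iff_univ.mpr h

/-- The space of pairs `(t, s)` with `s` a direction of `u t`. -/
def directionSpace {Z : Type*} (u : Z → ℂ) : Set (Z × ℂ) := {p | p.2 ∈ directions (u p.1)}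

theorem isCompact_directionSpace {Z : Type*} [TopologicalSpace Z] [CompactSpace Z]
    {u : Z → ℂ} (hu : Continuous u) : IsCompact (directionSpace u) := by
  refine (isCompact_univ.prod (isCompact_sphere (0 : ℂ) 1)).of_isClosed_subset ?_ ?_
  · exact (isClosed_eq (by fun_prop) continuous_const).inter
      (isClosed_eq (by fun_prop) (by fun_prop))
  · rintro p ⟨hp, -⟩
    exact ⟨Set.mem_univ _, by simpa using hp⟩

theorem isConnected_fiber_directionSpace {Z : Type*} [TopologicalSpace Z] (u : Z → ℂ) (t : Z) :
    IsConnected ((fun p : directionSpace u => p.1.1) ⁻¹' {t}) := by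
  have himage : Subtype.val '' ((fun p : directionSpace u => p.1.1) ⁻¹' {t}) =
      ({t} : Set Z) ×ˢ directions (u t) := by
    ext ⟨t', s⟩
    constructor
    · rintro ⟨⟨p, hp⟩, hpt, rfl⟩
      obtain rfl : t' = t := hpt
      exact ⟨rfl, hp⟩
    · rintro ⟨ht, hs⟩
      obtain rfl : t' = t := ht
      exact ⟨⟨(t', s), hs⟩, rfl, rfl⟩
  have h : IsConnected (({t} : Set Z) ×ˢ directions (u t)) :=
    isConnected_singleton.prod (isConnected_directions (u t))
  rw [← himage] at h
  exact ⟨h.nonempty.of_image, Topology.IsInducing.subtypeVal.isPreconnected_image.mp h.2⟩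

/-- For every continuum `Z` (not necessarily metrizable) and nonempty closed sets
`a, b, c` with empty intersection, there is a closed monotone continuous surjection
`g` from a continuum `Z′` onto `Z` such that the preimages of `a`, `b`, `c` can be
enlarged to a closed cover of `Z′` by three sets with empty intersection. -/
theorem exists_monotone_preimage_cover_general (Z : Type u) [TopologicalSpace Z]
    [CompactSpace Z] [T2Space Z] [ConnectedSpace Z] (a b c : Set Z)
    (ha : IsClosed a) (hb : IsClosed b) (hc : IsClosed c)
    (hane : a.Nonempty) (hbne : b.Nonempty) (hcne : c.Nonempty)
    (habc : a ∩ b ∩ c = ∅) :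
    ∃ (Z' : Type u) (_ : TopologicalSpace Z'), CompactSpace Z' ∧ T2Space Z' ∧
      ConnectedSpace Z' ∧
      ∃ g : Z' → Z, Continuous g ∧ Function.Surjective g ∧ IsClosedMap g ∧
        (∀ z : Z, IsConnected (g ⁻¹' {z})) ∧
        ∃ x y z : Set Z', IsClosed x ∧ IsClosed y ∧ IsClosed z ∧
          g ⁻¹' a ⊆ x ∧ g ⁻¹' b ⊆ y ∧ g ⁻¹' c ⊆ z ∧
          x ∩ y ∩ z = ∅ ∧ x ∪ y ∪ z = Set.univ := by
  obtain ⟨f₁, f₂, f₃, p₁, p₂, p₃, z₁, z₂, z₃, hne⟩ :=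
    exists_continuous_zero_of_inter_eq_empty ha hb hc habc
  let u : Z → ℂ := fun t =>
    ⟨f₁ t - (f₁ t + f₂ t + f₃ t) / 3, f₂ t - (f₁ t + f₂ t + f₃ t) / 3⟩
  have hu : Continuous u := by
    have : Continuous fun t => Complex.equivRealProdCLM.symm
        (f₁ t - (f₁ t + f₂ t + f₃ t) / 3, f₂ t - (f₁ t + f₂ t + f₃ t) / 3) := by fun_prop
    exact this
  have hu_zero : ∀ t, u t = 0 → f₁ t = f₂ t ∧ f₂ t = f₃ t := by
    intro t ht
    have h₁ : f₁ t - (f₁ t + f₂ t + f₃ t) / 3 = 0 := congrArg Complex.re ht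
    have h₂ : f₂ t - (f₁ t + f₂ t + f₃ t) / 3 = 0 := congrArg Complex.im ht
    constructor <;> linarith
  have hu_pos : ∀ t, f₁ t = 0 ∨ f₂ t = 0 ∨ f₃ t = 0 → 0 < ‖u t‖ := by
    refine fun t ht => norm_pos_iff.mpr fun h => ?_
    obtain ⟨h₁, h₂⟩ := hu_zero t h
    rcases ht with ht | ht | ht <;>
      exact hne t (by linarith) (by linarith) (by linarith)
  have hcoord : ∀ p : directionSpace u,
      f₁ p.1.1 - (f₁ p.1.1 + f₂ p.1.1 + f₃ p.1.1) / 3 = ‖u p.1.1‖ * p.1.2.re ∧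
      f₂ p.1.1 - (f₁ p.1.1 + f₂ p.1.1 + f₃ p.1.1) / 3 = ‖u p.1.1‖ * p.1.2.im := by
    rintro ⟨⟨t, s⟩, -, h⟩
    have h₁ := congrArg Complex.re h
    have h₂ := congrArg Complex.im h
    rw [Complex.re_ofReal_mul] at h₁
    rw [Complex.im_ofReal_mul] at h₂
    exact ⟨h₁, h₂⟩
  have : CompactSpace (directionSpace u) :=
    isCompact_iff_compactSpace.mp (isCompact_directionSpace hu)
  have hg : Continuous fun p : directionSpace u => p.1.1 := by fun_prop
  have hfib := isConnected_fiber_directionSpace u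
  refine ⟨directionSpace u, inferInstance, inferInstance, inferInstance,
    connectedSpace_of_isClosedMap_of_connected_fibers hg hg.isClosedMap hfib,
    fun p => p.1.1, hg, fun t => (hfib t).nonempty, hg.isClosedMap, hfib,
    {p | p.1.2.re ≤ p.1.2.im ∧ p.1.2.re ≤ -p.1.2.re - p.1.2.im},
    {p | p.1.2.im ≤ p.1.2.re ∧ p.1.2.im ≤ -p.1.2.re - p.1.2.im},
    {p | -p.1.2.re - p.1.2.im ≤ p.1.2.re ∧ -p.1.2.re - p.1.2.im ≤ p.1.2.im},
    ?_, ?_, ?_, ?_, ?_, ?_, ?_, ?_⟩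
  iterate 3
    rw [Set.ofPred_and]
    refine IsClosed.inter ?_ ?_ <;> exact isClosed_le (by fun_prop) (by fun_prop)
  · intro p hp
    have h₀ := z₁ p.1.1 hp
    obtain ⟨h₁, h₂⟩ := hcoord p
    have h₃ := p₂ p.1.1
    have h₄ := p₃ p.1.1
    have hpos := hu_pos p.1.1 (by simp [h₀])
    exact ⟨le_of_mul_le_mul_left (by linarith) hpos, le_of_mul_le_mul_left (by linarith) hpos⟩
  · intro p hp
    have h₀ := z₂ p.1.1 hp
    obtain ⟨h₁, h₂⟩ := hcoord p
    have h₃ := p₁ p.1.1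
    have h₄ := p₃ p.1.1
    have hpos := hu_pos p.1.1 (by simp [h₀])
    exact ⟨le_of_mul_le_mul_left (by linarith) hpos, le_of_mul_le_mul_left (by linarith) hpos⟩
  · intro p hp
    have h₀ := z₃ p.1.1 hp
    obtain ⟨h₁, h₂⟩ := hcoord p
    have h₃ := p₁ p.1.1
    have h₄ := p₂ p.1.1
    have hpos := hu_pos p.1.1 (by simp [h₀])
    exact ⟨le_of_mul_le_mul_left (by linarith) hpos, le_of_mul_le_mul_left (by linarith) hpos⟩
  · refine Set.eq_empty_of_forall_notMem ?_
    rintro ⟨⟨t, s⟩, hs, hts⟩ ⟨⟨⟨h₁, h₂⟩, h₃, h₄⟩, h₅, h₆⟩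
    dsimp only at hs h₁ h₂ h₃ h₄ h₅ h₆
    have : s = 0 := Complex.ext (by simp only [Complex.zero_re]; linarith)
      (by simp only [Complex.zero_im]; linarith)
    simp [this] at hs
  · refine Set.eq_univ_of_forall fun p => ?_
    simp only [Set.mem_union, Set.mem_ofPred_eq]
    grind
end
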